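/- arXiv:1309.4810 — 3 statements merged into one kernel-verified Lean document; each statement's English description precedes it below -/
import Mathlib

section
/- For every integer n ≥ 1, the abelian complexity of the Tribonacci word satisfies ρ_t(n) ∈ {3, 4, 5, 6, 7}. -/
/-- The m-bonacci substitution on letters. -/
def mbSub (m : ℕ) (ℓ : ℕ) : List ℕ :=
  if ℓ = m - 1 then [0] else [0, ℓ + 1]

/-- Application of the m-bonacci substitution to a word. -/
def mbApply (m : ℕ) (w : List ℕ) : List ℕ := w.flatMap (mbSub m)

/-- σ_m^k(0). -/
def mbIter (m k : ℕ) : List ℕ := (mbApply m)^[k] [0]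

/-- w is a factor of the m-bonacci word. -/
def mbFactor (m : ℕ) (w : List ℕ) : Prop := ∃ k, w <:+: mbIter m k

/-- The prefix of length n of the m-bonacci word. -/
def mbPrefix (m n : ℕ) : List ℕ := (mbIter m n).take n

/-- Abelian complexity: number of distinct Parikh vectors of factors of length n. -/
noncomputable def mbAC (m n : ℕ) : ℕ :=
  Set.ncard ((fun (w : List ℕ) (ℓ : ℕ) => w.count ℓ) ''
    {w : List ℕ | mbFactor m w ∧ w.length = n})

/-- Tribonacci numbers. -/
def tribN : ℕ → ℕ
  | 0 => 0
  | 1 => 0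
  | 2 => 1
  | n + 3 => tribN (n + 2) + tribN (n + 1) + tribN n

/-- Value of a digit string (most significant digit first) in the Tribonacci system. -/
def valT : List ℕ → ℕ
  | [] => 0
  | d :: rest => d * tribN (rest.length + 3) + valT rest

/-- L is the normal T-representation of n (MSB first, greedy). -/
def IsNormalTRep (n : ℕ) (L : List ℕ) : Prop :=
  (∀ d ∈ L, d ≤ 1) ∧ (∀ d ∈ L.take 1, d = 1) ∧ valT L = n ∧
    ∀ S, S <:+ L → valT S < tribN (S.length + 3)

/-- Value of a digit string (MSB first) in the m-bonacci numeration system U_j = |σ_m^j(0)|. -/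
def valU (m : ℕ) : List ℕ → ℕ
  | [] => 0
  | d :: rest => d * (mbIter m rest.length).length + valU m rest

/-- L is the normal U-representation of n (MSB first, greedy) in the m-bonacci system. -/
def IsNormalURep (m n : ℕ) (L : List ℕ) : Prop :=
  (∀ d ∈ L, d ≤ 1) ∧ (∀ d ∈ L.take 1, d = 1) ∧ valU m L = n ∧
    ∀ S, S <:+ L → valU m S < (mbIter m S.length).length

/-! ### The substitution and its iterates -/

theorem mbApply_append (m : ℕ) (u v : List ℕ) :
    mbApply m (u ++ v) = mbApply m u ++ mbApply m v := by
  simp [mbApply]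

theorem mbApply_cons (m a : ℕ) (w : List ℕ) :
    mbApply m (a :: w) = mbSub m a ++ mbApply m w := by
  simp [mbApply]

theorem mbIter_succ (m k : ℕ) : mbIter m (k + 1) = mbApply m (mbIter m k) := by
  simp only [mbIter, Function.iterate_succ_apply']

theorem List.IsPrefix.mbApply {u v : List ℕ} (m : ℕ) (h : u <+: v) :
    mbApply m u <+: mbApply m v := by
  obtain ⟨t, rfl⟩ := h
  rw [mbApply_append]
  exact List.prefix_append _ _

theorem List.IsInfix.mbApply {u v : List ℕ} (m : ℕ) (h : u <:+: v) :
    mbApply m u <:+: mbApply m v := by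
  obtain ⟨s, t, rfl⟩ := h
  rw [mbApply_append, mbApply_append]
  exact ⟨_, _, rfl⟩

theorem mbIter_prefix_succ (k : ℕ) : mbIter 3 k <+: mbIter 3 (k + 1) := by
  induction k with
  | zero => decide
  | succ k ih =>
    rw [mbIter_succ 3 k, mbIter_succ 3 (k + 1)]
    exact ih.mbApply 3

theorem mbIter_prefix_of_le {j k : ℕ} (h : j ≤ k) : mbIter 3 j <+: mbIter 3 k := by
  induction k, h using Nat.le_induction with
  | base => exact List.prefix_rfl
  | succ k _ ih => exact ih.trans (mbIter_prefix_succ k)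

theorem lt_of_mem_mbIter {k x : ℕ} (hx : x ∈ mbIter 3 k) : x < 3 := by
  induction k generalizing x with
  | zero =>
    simp only [mbIter, Function.iterate_zero, id_eq, List.mem_singleton] at hx
    omega
  | succ k ih =>
    rw [mbIter_succ, mbApply, List.mem_flatMap] at hx
    obtain ⟨a, ha, hx⟩ := hx
    have := ih ha
    unfold mbSub at hx
    split_ifs at hx <;> simp at hx <;> omega

theorem length_le_length_mbApply (m : ℕ) (w : List ℕ) : w.length ≤ (mbApply m w).length := by
  induction w with
  | nil => simp
  | cons a w ih =>
    rw [mbApply_cons, mbSub]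
    split_ifs <;> simp <;> omega

theorem lt_length_mbIter (k : ℕ) : k < (mbIter 3 k).length := by
  induction k with
  | zero => simp [mbIter]
  | succ k ih =>
    obtain ⟨r, hr⟩ := mbIter_prefix_of_le (Nat.zero_le k)
    have h0 : mbIter 3 0 = [0] := rfl
    rw [h0] at hr
    have := length_le_length_mbApply 3 r
    rw [mbIter_succ]
    rw [← hr] at ih ⊢
    rw [List.singleton_append, mbApply_cons]
    simp [mbSub] at ih ⊢
    omega

/-! ### Parikh vectors -/

theorem length_eq_count {w : List ℕ} (hw : ∀ x ∈ w, x < 3) :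
    w.length = w.count 0 + w.count 1 + w.count 2 := by
  induction w with
  | nil => simp
  | cons a w ih =>
    have h := ih fun x hx => hw x (List.mem_cons_of_mem _ hx)
    have ha := hw a List.mem_cons_self
    interval_cases a <;> simp [h] <;> omega

theorem count_mbApply {w : List ℕ} (hw : ∀ x ∈ w, x < 3) :
    (mbApply 3 w).count 0 = w.count 0 + w.count 1 + w.count 2 ∧
      (mbApply 3 w).count 1 = w.count 0 ∧ (mbApply 3 w).count 2 = w.count 1 := by
  induction w with
  | nil => simp [mbApply]
  | cons a w ih =>
    obtain ⟨h0, h1, h2⟩ := ih fun x hx => hw x (List.mem_cons_of_mem _ hx)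
    have ha := hw a List.mem_cons_self
    rw [mbApply_cons]
    interval_cases a <;> simp [mbSub, h0, h1, h2] <;> omega

theorem exists_prefix_of_prefix_mbApply {p w : List ℕ} (h : p <+: mbApply 3 w) :
    ∃ q, q <+: w ∧ (p = mbApply 3 q ∨ p = mbApply 3 q ++ [0]) := by
  induction w generalizing p with
  | nil =>
    refine ⟨[], List.prefix_rfl, Or.inl ?_⟩
    simpa [mbApply] using h
  | cons a w ih =>
    rw [mbApply_cons] at h
    by_cases hp : mbSub 3 a <+: p
    · obtain ⟨r, rfl⟩ := hp
      obtain ⟨q, hq, hr⟩ := ih ((List.prefix_append_right_inj _).1 h)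
      refine ⟨a :: q, by simpa using hq, ?_⟩
      rw [mbApply_cons]
      rcases hr with rfl | rfl <;> simp
    · refine ⟨[], List.nil_prefix, ?_⟩
      have hpa : p <+: mbSub 3 a :=
        (List.prefix_or_prefix_of_prefix h (List.prefix_append _ _)).resolve_right hp
      unfold mbSub at hp hpa
      rcases p with _ | ⟨x, _ | ⟨y, p⟩⟩
      · simp [mbApply]
      · split_ifs at hp hpa <;> simp_all [mbApply]
      · split_ifs at hp hpa <;> simp_all [List.cons_prefix_cons]

/-- Parikh vectors of prefixes of the iterates, read off one digit of the numeration system. -/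
theorem exists_count_of_prefix_mbIter_succ {k : ℕ} {p : List ℕ} (h : p <+: mbIter 3 (k + 1)) :
    ∃ q, q <+: mbIter 3 k ∧ ∃ e ≤ 1, p.count 0 = q.count 0 + q.count 1 + q.count 2 + e ∧
      p.count 1 = q.count 0 ∧ p.count 2 = q.count 1 := by
  rw [mbIter_succ] at h
  obtain ⟨q, hq, hp⟩ := exists_prefix_of_prefix_mbApply h
  obtain ⟨h0, h1, h2⟩ := count_mbApply fun x hx => lt_of_mem_mbIter (hq.subset hx)
  refine ⟨q, hq, ?_⟩
  rcases hp with rfl | rfl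
  · exact ⟨0, by simp, by simp [h0, h1, h2]⟩
  · exact ⟨1, by simp, by simp [h0, h1, h2]⟩

/-! ### Balance -/

/-- A finite region of difference vectors, containing those with letter sum zero. -/
def CoreRegion (x y z : ℤ) : Prop :=
  (-3 ≤ x ∧ x ≤ 3) ∧ (-3 ≤ y ∧ y ≤ 3) ∧ (-3 ≤ z ∧ z ≤ 3) ∧ (-6 ≤ y - 2 * z ∧ y - 2 * z ≤ 6) ∧
    (-6 ≤ x - 2 * y ∧ x - 2 * y ≤ 6) ∧ (-4 ≤ x - y - z ∧ x - y - z ≤ 4)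

/-- A cone of difference vectors that is never left again. -/
def EscapeRegion (x y z : ℤ) : Prop :=
  3 ≤ x + y + z ∧ 5 ≤ 2 * x + 2 * y + z ∧ 9 ≤ 4 * x + 3 * y + 2 * z

instance (x y z : ℤ) : Decidable (CoreRegion x y z) := by
  unfold CoreRegion; infer_instance

instance (x y z : ℤ) : Decidable (EscapeRegion x y z) := by
  unfold EscapeRegion; infer_instance

/-- The invariant satisfied by alternating sums of Parikh vectors of four prefixes. -/
def AdmissibleDiff (x y z : ℤ) : Prop :=
  CoreRegion x y z ∨ EscapeRegion x y z ∨ EscapeRegion (-x) (-y) (-z)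

theorem CoreRegion.step {x y z c : ℤ} (h : CoreRegion x y z) (hc : -2 ≤ c) (hc' : c ≤ 2) :
    AdmissibleDiff (x + y + z + c) x y := by
  have key : ∀ x ∈ Finset.Icc (-3 : ℤ) 3, ∀ y ∈ Finset.Icc (-3 : ℤ) 3,
      ∀ z ∈ Finset.Icc (-3 : ℤ) 3, ∀ c ∈ Finset.Icc (-2 : ℤ) 2, CoreRegion x y z →
      CoreRegion (x + y + z + c) x y ∨ EscapeRegion (x + y + z + c) x y ∨
        EscapeRegion (-(x + y + z + c)) (-x) (-y) := by
    decide +kernel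
  exact key x (Finset.mem_Icc.2 h.1) y (Finset.mem_Icc.2 h.2.1) z (Finset.mem_Icc.2 h.2.2.1) c
    (Finset.mem_Icc.2 ⟨hc, hc'⟩) h

theorem AdmissibleDiff.step {x y z c : ℤ} (h : AdmissibleDiff x y z) (hc : -2 ≤ c) (hc' : c ≤ 2) :
    AdmissibleDiff (x + y + z + c) x y := by
  rcases h with h | h | h
  · exact h.step hc hc'
  all_goals
    unfold AdmissibleDiff EscapeRegion at *
    omega

theorem AdmissibleDiff.bounded {x y z : ℤ} (h : AdmissibleDiff x y z) (hs : x + y + z = 0) :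
    x ≤ 2 ∧ y ≤ 2 ∧ z ≤ 2 := by
  unfold AdmissibleDiff CoreRegion EscapeRegion at h
  omega

theorem admissibleDiff_of_prefix {k : ℕ} {p q r s : List ℕ} (hp : p <+: mbIter 3 k)
    (hq : q <+: mbIter 3 k) (hr : r <+: mbIter 3 k) (hs : s <+: mbIter 3 k) :
    AdmissibleDiff (p.count 0 - q.count 0 - r.count 0 + s.count 0)
      (p.count 1 - q.count 1 - r.count 1 + s.count 1)
      (p.count 2 - q.count 2 - r.count 2 + s.count 2) := by
  induction k generalizing p q r s with
  | zero =>
    have key : ∀ u : List ℕ, u <+: mbIter 3 0 → u.count 0 ≤ 1 ∧ u.count 1 = 0 ∧ u.count 2 = 0 :=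
      fun u hu => ⟨hu.sublist.count_le 0, Nat.le_zero.1 (hu.sublist.count_le 1),
        Nat.le_zero.1 (hu.sublist.count_le 2)⟩
    have h1 := key p hp
    have h2 := key q hq
    have h3 := key r hr
    have h4 := key s hs
    unfold AdmissibleDiff CoreRegion
    omega
  | succ k ih =>
    obtain ⟨p', hp', e₁, he₁, hp0, hp1, hp2⟩ := exists_count_of_prefix_mbIter_succ hp
    obtain ⟨q', hq', e₂, he₂, hq0, hq1, hq2⟩ := exists_count_of_prefix_mbIter_succ hq
    obtain ⟨r', hr', e₃, he₃, hr0, hr1, hr2⟩ := exists_count_of_prefix_mbIter_succ hr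
    obtain ⟨s', hs', e₄, he₄, hs0, hs1, hs2⟩ := exists_count_of_prefix_mbIter_succ hs
    have h := (ih hp' hq' hr' hs').step (c := e₁ - e₂ - e₃ + e₄) (by omega) (by omega)
    convert h using 1 <;> push_cast [*] <;> ring

/-- The Tribonacci word is 2-balanced. -/
theorem mbFactor_balanced {u v : List ℕ} (hu : mbFactor 3 u) (hv : mbFactor 3 v)
    (huv : u.length = v.length) :
    u.count 0 ≤ v.count 0 + 2 ∧ u.count 1 ≤ v.count 1 + 2 ∧ u.count 2 ≤ v.count 2 + 2 := by
  obtain ⟨j, hu⟩ := hu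
  obtain ⟨k, hv⟩ := hv
  obtain ⟨a, b, hu⟩ := hu.trans (mbIter_prefix_of_le (le_max_left j k)).isInfix
  obtain ⟨c, d, hv⟩ := hv.trans (mbIter_prefix_of_le (le_max_right j k)).isInfix
  have pu : a ++ u <+: mbIter 3 (max j k) := ⟨b, hu⟩
  have pv : c ++ v <+: mbIter 3 (max j k) := ⟨d, hv⟩
  have h := admissibleDiff_of_prefix pu ((List.prefix_append a u).trans pu) pv
    ((List.prefix_append c v).trans pv)
  have lu : u.length = _ := length_eq_count fun x hx =>
    lt_of_mem_mbIter (pu.subset (List.mem_append_right a hx))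
  have lv : v.length = _ := length_eq_count fun x hx =>
    lt_of_mem_mbIter (pv.subset (List.mem_append_right c hx))
  simp only [List.count_append, Nat.cast_add] at h
  have := h.bounded (by omega)
  omega

theorem mbFactor.lt_three {w : List ℕ} (hw : mbFactor 3 w) {x : ℕ} (hx : x ∈ w) : x < 3 := by
  obtain ⟨k, hk⟩ := hw
  exact lt_of_mem_mbIter (hk.subset hx)

/-! ### Counting Parikh vectors -/

/-- Every iterate can be extended to the left by each letter. -/
theorem mbFactor_cons_mbIter (k : ℕ) {a : ℕ} (ha : a < 3) : mbFactor 3 (a :: mbIter 3 k) := by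
  induction k generalizing a with
  | zero =>
    refine ⟨4, ?_⟩
    interval_cases a <;> decide
  | succ k ih =>
    obtain ⟨b, hb, t, ht⟩ : ∃ b < 3, ∃ t, mbSub 3 b = t ++ [a] := by
      interval_cases a
      · exact ⟨2, by simp, [], rfl⟩
      · exact ⟨0, by simp, [0], rfl⟩
      · exact ⟨1, by simp, [0], rfl⟩
    obtain ⟨K, hK⟩ := ih hb
    refine ⟨K + 1, ?_⟩
    rw [mbIter_succ, mbIter_succ]
    refine List.IsInfix.trans ?_ (hK.mbApply 3)
    rw [mbApply_cons, ht, List.append_assoc]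
    exact (List.suffix_append _ _).isInfix

theorem mbFactor_cons_take (k n : ℕ) {a : ℕ} (ha : a < 3) :
    mbFactor 3 (a :: (mbIter 3 k).take n) := by
  obtain ⟨K, hK⟩ := mbFactor_cons_mbIter k ha
  refine ⟨K, List.IsInfix.trans (List.IsPrefix.isInfix ?_) hK⟩
  simpa using List.take_prefix n _

theorem card_bounded_triples_le (s : ℕ) :
    (((Finset.range 3 ×ˢ Finset.range 3 ×ˢ Finset.range 3).filter
      fun v => v.1 + v.2.1 + v.2.2 = s).card) ≤ 7 := by
  by_cases hs : s < 7
  · interval_cases s <;> decide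
  · rw [Finset.filter_false_of_mem]
    · simp
    · simp only [Finset.mem_product, Finset.mem_range]
      omega

/-- A nonempty set of naturals of diameter at most 2 lies in an interval of three integers. -/
theorem exists_window {S : Set (ℕ → ℕ)} (hS : S.Nonempty) (i : ℕ)
    (h : ∀ u ∈ S, ∀ v ∈ S, u i ≤ v i + 2) : ∃ m, ∀ u ∈ S, m ≤ u i ∧ u i < m + 3 := by
  obtain ⟨v, hv, hm⟩ := Nat.sInf_mem (hS.image fun u => u i)
  refine ⟨v i, fun u hu => ⟨?_, Nat.lt_succ_of_le (h u hu v hv)⟩⟩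
  simp only at hm
  rw [hm]
  exact Nat.sInf_le ⟨u, hu, rfl⟩

/-- A 2-balanced set of ternary vectors with constant letter sum is finite with at most
seven elements. -/
theorem finite_and_ncard_le_seven {S : Set (ℕ → ℕ)} {n : ℕ}
    (hsupp : ∀ u ∈ S, ∀ i, 3 ≤ i → u i = 0) (hsum : ∀ u ∈ S, u 0 + u 1 + u 2 = n)
    (hbal : ∀ i < 3, ∀ u ∈ S, ∀ v ∈ S, u i ≤ v i + 2) : S.Finite ∧ S.ncard ≤ 7 := by
  rcases S.eq_empty_or_nonempty with rfl | hS
  · simp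
  obtain ⟨a, ha⟩ := exists_window hS 0 (hbal 0 (by simp))
  obtain ⟨b, hb⟩ := exists_window hS 1 (hbal 1 (by simp))
  obtain ⟨c, hc⟩ := exists_window hS 2 (hbal 2 (by simp))
  let T := (Finset.range 3 ×ˢ Finset.range 3 ×ˢ Finset.range 3).filter
    fun v => v.1 + v.2.1 + v.2.2 = n - (a + b + c)
  let f : (ℕ → ℕ) → ℕ × ℕ × ℕ := fun u => (u 0 - a, u 1 - b, u 2 - c)
  have hmaps : ∀ u ∈ S, f u ∈ (T : Set (ℕ × ℕ × ℕ)) := by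
    intro u hu
    have := ha u hu
    have := hb u hu
    have := hc u hu
    have := hsum u hu
    simp only [T, f, Finset.coe_filter, Finset.mem_product, Finset.mem_range, Set.mem_ofPred_eq]
    omega
  have hinj : Set.InjOn f S := by
    intro u hu v hv huv
    simp only [f, Prod.mk.injEq] at huv
    have := ha u hu
    have := hb u hu
    have := hc u hu
    have := ha v hv
    have := hb v hv
    have := hc v hv
    funext i
    by_cases hi : i < 3
    · interval_cases i <;> omega
    · rw [hsupp u hu i (by omega), hsupp v hv i (by omega)]
  refine ⟨Set.Finite.of_injOn hmaps hinj T.finite_toSet, ?_⟩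
  calc S.ncard ≤ (T : Set (ℕ × ℕ × ℕ)).ncard :=
        Set.ncard_le_ncard_of_injOn f hmaps hinj T.finite_toSet
    _ = T.card := Set.ncard_coe_finset T
    _ ≤ 7 := card_bounded_triples_le _

theorem tribonacci_abelian_complexity_range (n : ℕ) (hn : 1 ≤ n) :
    mbAC 3 n ∈ ({3, 4, 5, 6, 7} : Set ℕ) := by
  unfold mbAC
  set S := (fun (w : List ℕ) (ℓ : ℕ) => w.count ℓ) ''
    {w : List ℕ | mbFactor 3 w ∧ w.length = n}
  obtain ⟨hfin, hle⟩ : S.Finite ∧ S.ncard ≤ 7 := by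
    refine finite_and_ncard_le_seven (n := n) ?_ ?_ ?_
    · rintro _ ⟨w, ⟨hw, -⟩, rfl⟩ i hi
      exact List.count_eq_zero.2 fun h => absurd (hw.lt_three h) (by omega)
    · rintro _ ⟨w, ⟨hw, hlen⟩, rfl⟩
      exact (length_eq_count fun x => hw.lt_three).symm.trans hlen
    · rintro i hi _ ⟨u, ⟨hu, hul⟩, rfl⟩ _ ⟨v, ⟨hv, hvl⟩, rfl⟩
      obtain ⟨h0, h1, h2⟩ := mbFactor_balanced hu hv (hul.trans hvl.symm)
      interval_cases i <;> assumption
  have hmem : ∀ a < 3, (fun ℓ => (a :: (mbIter 3 n).take (n - 1)).count ℓ) ∈ S := by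
    refine fun a ha => ⟨_, ⟨mbFactor_cons_take n (n - 1) ha, ?_⟩, rfl⟩
    have := lt_length_mbIter n
    simp
    omega
  have hge : 2 < S.ncard := by
    refine (Set.two_lt_ncard_iff hfin).2 ⟨_, _, _, hmem 0 (by simp), hmem 1 (by simp),
      hmem 2 (by simp), fun h => ?_, fun h => ?_, fun h => ?_⟩
    · simpa using congrFun h 0
    · simpa using congrFun h 0
    · simpa using congrFun h 1
  simp only [Set.mem_insert_iff, Set.mem_singleton_iff]
  omega
end

section
/- The Tribonacci word is 2-balanced: for every letter ℓ ∈ {0,1,2} and every pair of factors v, w of t with |v| = |w|, one has ||v|_ℓ − |w|_ℓ| ≤ 2. -/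
theorem mbIter_three_add_three (k : ℕ) :
    mbIter 3 (k + 3) = mbIter 3 (k + 2) ++ mbIter 3 (k + 1) ++ mbIter 3 k := by
  have hsucc (k : ℕ) : mbIter 3 (k + 1) = mbApply 3 (mbIter 3 k) :=
    Function.iterate_succ_apply' _ _ _
  induction k with
  | zero => decide
  | succ k ih =>
    have h := congrArg (mbApply 3) ih
    simp only [mbApply, List.flatMap_append] at h
    simpa only [hsucc, mbApply] using h

theorem List.IsPrefix.of_append {α : Type*} {u x y : List α} (h : u <+: x ++ y) :
    u <+: x ∨ ∃ z, z <+: y ∧ u = x ++ z := by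
  obtain ⟨t, ht⟩ := h
  rcases List.append_eq_append_iff.1 ht with ⟨z, hz, -⟩ | ⟨z, hz, hy⟩
  · exact .inl ⟨z, hz.symm⟩
  · exact .inr ⟨z, ⟨t, hy.symm⟩, hz⟩

theorem le_sum_posPart_of_prefix {φ : List ℕ → ℝ} (hφ : ∀ u v, φ (u ++ v) = φ u + φ v)
    (k : ℕ) {u : List ℕ} (hu : u <+: mbIter 3 k) :
    φ u ≤ ∑ j ∈ Finset.range (k + 1), max (φ (mbIter 3 j)) 0 := by
  have hnil : φ [] = 0 := by simpa using hφ [] []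
  induction k using Nat.strong_induction_on generalizing u with
  | _ k ih =>
    match k with
    | 0 =>
      have h0 : mbIter 3 0 = [0] := by decide
      simp only [h0, List.prefix_cons_iff, List.prefix_nil] at hu
      rcases hu with rfl | ⟨_, rfl, rfl⟩ <;> simp [hnil, h0]
    | 1 =>
      have h0 : mbIter 3 0 = [0] := by decide
      have h1 : mbIter 3 1 = [0, 1] := by decide
      simp only [h1, List.prefix_cons_iff, List.prefix_nil] at hu
      simp only [Finset.sum_range_succ, Finset.sum_range_zero, h0, h1]
      rcases hu with rfl | ⟨_, rfl, rfl | ⟨_, rfl, rfl⟩⟩ <;> grind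
    | 2 =>
      have h0 : mbIter 3 0 = [0] := by decide
      have h1 : mbIter 3 1 = [0, 1] := by decide
      have h2 : mbIter 3 2 = [0, 1, 0, 2] := by decide
      have h3 : φ [0, 1, 0] = φ [0, 1] + φ [0] := hφ [0, 1] [0]
      simp only [h2, List.prefix_cons_iff, List.prefix_nil] at hu
      simp only [Finset.sum_range_succ, Finset.sum_range_zero, h0, h1, h2]
      rcases hu with rfl | ⟨_, rfl, rfl | ⟨_, rfl, rfl | ⟨_, rfl, rfl | ⟨_, rfl, rfl⟩⟩⟩⟩ <;> grind
    | k + 3 =>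
      rw [mbIter_three_add_three] at hu
      have e1 := Finset.sum_range_succ (fun j => max (φ (mbIter 3 j)) 0) (k + 3)
      have e2 := Finset.sum_range_succ (fun j => max (φ (mbIter 3 j)) 0) (k + 2)
      have e3 := Finset.sum_range_succ (fun j => max (φ (mbIter 3 j)) 0) (k + 1)
      have n1 := le_max_right (φ (mbIter 3 (k + 3))) 0
      have n2 := le_max_left (φ (mbIter 3 (k + 2))) 0
      have n3 := le_max_left (φ (mbIter 3 (k + 1))) 0
      rw [Finset.sum_range_succ]
      rcases hu.of_append with hu | ⟨z, hz, rfl⟩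
      · rcases hu.of_append with hu | ⟨z, hz, rfl⟩
        · have := ih (k + 2) (by omega) hu
          linarith
        · have := ih (k + 1) (by omega) hz
          rw [hφ]
          linarith
      · have := ih k (by omega) hz
        rw [hφ, hφ]
        linarith

theorem le_sum_abs_of_infix {φ : List ℕ → ℝ} (hφ : ∀ u v, φ (u ++ v) = φ u + φ v)
    {k : ℕ} {v : List ℕ} (hv : v <:+: mbIter 3 k) :
    φ v ≤ ∑ j ∈ Finset.range (k + 1), |φ (mbIter 3 j)| := by
  obtain ⟨x, y, h⟩ := hv
  have hxv := le_sum_posPart_of_prefix hφ k (u := x ++ v) ⟨y, h⟩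
  have hx := le_sum_posPart_of_prefix (φ := fun u => -φ u)
    (fun u v => by rw [hφ]; ring) k (u := x) ⟨v ++ y, by rw [← h, List.append_assoc]⟩
  have habs : ∑ j ∈ Finset.range (k + 1), |φ (mbIter 3 j)| =
      ∑ j ∈ Finset.range (k + 1), max (φ (mbIter 3 j)) 0 +
      ∑ j ∈ Finset.range (k + 1), max (-φ (mbIter 3 j)) 0 := by
    rw [← Finset.sum_add_distrib]
    refine Finset.sum_congr rfl fun j _ => ?_
    grind
  rw [hφ] at hxv
  linarith

theorem abs_le_sum_abs_of_infix {φ : List ℕ → ℝ} (hφ : ∀ u v, φ (u ++ v) = φ u + φ v)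
    {k : ℕ} {v : List ℕ} (hv : v <:+: mbIter 3 k) :
    |φ v| ≤ ∑ j ∈ Finset.range (k + 1), |φ (mbIter 3 j)| := by
  refine abs_le'.2 ⟨le_sum_abs_of_infix hφ hv, ?_⟩
  simpa using le_sum_abs_of_infix (φ := fun u => -φ u) (fun u v => by rw [hφ]; ring) hv

theorem sum_abs_le_of_recurrence {d : ℕ → ℝ} {p q : ℝ}
    (hd : ∀ k, d (k + 4) = p * d (k + 1) + q * d k) (n : ℕ) :
    (1 - (|p| + |q|)) * ∑ j ∈ Finset.range (n + 4), |d j| ≤ ∑ j ∈ Finset.range 4, |d j| := by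
  have h1 : ∑ j ∈ Finset.range (n + 4), |d j| =
      ∑ j ∈ Finset.range 4, |d j| + ∑ j ∈ Finset.range n, |d (j + 4)| := by
    rw [add_comm n, Finset.sum_range_add]
    simp only [add_comm 4]
  have h2 : ∑ j ∈ Finset.range n, |d (j + 4)| ≤
      |p| * ∑ j ∈ Finset.range n, |d (j + 1)| + |q| * ∑ j ∈ Finset.range n, |d j| := by
    rw [Finset.mul_sum, Finset.mul_sum, ← Finset.sum_add_distrib]
    refine Finset.sum_le_sum fun j _ => ?_
    rw [hd, ← abs_mul, ← abs_mul]
    exact abs_add_le _ _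
  have hmono {m : ℕ} (hm : m ≤ n + 4) :
      ∑ j ∈ Finset.range m, |d j| ≤ ∑ j ∈ Finset.range (n + 4), |d j| :=
    Finset.sum_le_sum_of_subset_of_nonneg (Finset.range_subset_range.2 hm)
      fun _ _ _ => abs_nonneg _
  have h3 : ∑ j ∈ Finset.range n, |d (j + 1)| ≤ ∑ j ∈ Finset.range (n + 4), |d j| := by
    have := Finset.sum_range_succ' (fun j => |d j|) n
    have := hmono (m := n + 1) (by omega)
    have := abs_nonneg (d 0)
    linarith
  have h4 := hmono (m := n) (by omega)
  have h5 := mul_le_mul_of_nonneg_left h3 (abs_nonneg p)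
  have h6 := mul_le_mul_of_nonneg_left h4 (abs_nonneg q)
  linarith

theorem exists_inv_tribonacci_root :
    ∃ b : ℝ, 0.54368901 < b ∧ b < 0.54368902 ∧ b ^ 3 + b ^ 2 + b = 1 := by
  have hc : ContinuousOn (fun x : ℝ => x ^ 3 + x ^ 2 + x) (Set.Icc 0.54368901 0.54368902) := by
    fun_prop
  obtain ⟨b, hb, h⟩ := intermediate_value_Ioo (by norm_num) hc
    (show (1 : ℝ) ∈ Set.Ioo _ _ by constructor <;> norm_num)
  exact ⟨b, hb.1, hb.2, h⟩

theorem contracting_recurrence {d : ℕ → ℝ} {b : ℝ} (hb0 : 0 < b) (hb : b ^ 3 + b ^ 2 + b = 1)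
    (hd : ∀ k, d (k + 3) = d (k + 2) + d (k + 1) + d k)
    (h0 : d 2 + (b + b ^ 2) * d 1 + b * d 0 = 0) (k : ℕ) :
    d (k + 2) + (b + b ^ 2) * d (k + 1) + b * d k = 0 := by
  induction k with
  | zero => exact h0
  | succ k ih =>
    have h : b * (d (k + 3) + (b + b ^ 2) * d (k + 2) + b * d (k + 1)) = 0 := by
      rw [hd]
      linear_combination ih + d (k + 2) * hb
    exact (mul_eq_zero.1 h).resolve_left hb0.ne'

theorem sum_abs_lt_of_tribonacci_recurrence {d : ℕ → ℝ} {b : ℝ}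
    (hlo : 0.54368901 < b) (hhi : b < 0.54368902) (hb : b ^ 3 + b ^ 2 + b = 1)
    (hd : ∀ k, d (k + 3) = d (k + 2) + d (k + 1) + d k)
    (h0 : d 2 + (b + b ^ 2) * d 1 + b * d 0 = 0)
    (hsmall : ∑ j ∈ Finset.range 8, |d j| + 100 / 58 * ∑ j ∈ Finset.range 4, |d (8 + j)| < 3 / 2)
    (n : ℕ) : ∑ j ∈ Finset.range n, |d j| < 3 / 2 := by
  have hrec := contracting_recurrence (by linarith) hb hd h0
  obtain ⟨a, ha⟩ : ∃ a, a = b + b ^ 2 := ⟨_, rfl⟩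
  rw [← ha] at hrec
  have halo : 0.839286 < a := by nlinarith
  have hahi : a < 0.839287 := by nlinarith
  have hrec4 (k : ℕ) : d (8 + (k + 4)) =
      (2 * a * b - a ^ 3) * d (8 + (k + 1)) + (b ^ 2 - a ^ 2 * b) * d (8 + k) := by
    have h1 := hrec (8 + k)
    have h2 := hrec (8 + k + 1)
    have h3 := hrec (8 + k + 2)
    simp only [← add_assoc] at *
    linear_combination h3 - a * h2 + (a ^ 2 - b) * h1
  have hq : |b ^ 2 - a ^ 2 * b| ≤ 0.09 := by
    rw [abs_le]; constructor <;> nlinarith [mul_pos (sub_pos.2 halo) (sub_pos.2 hlo)]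
  have hp : |2 * a * b - a ^ 3| ≤ 0.33 := by
    rw [abs_le]; constructor <;> nlinarith [mul_pos (sub_pos.2 halo) (sub_pos.2 hlo)]
  have htail := sum_abs_le_of_recurrence (d := fun j => d (8 + j)) hrec4 n
  have hnonneg : 0 ≤ ∑ j ∈ Finset.range (n + 4), |d (8 + j)| :=
    Finset.sum_nonneg fun _ _ => abs_nonneg _
  have hmono : ∑ j ∈ Finset.range n, |d j| ≤ ∑ j ∈ Finset.range (8 + (n + 4)), |d j| :=
    Finset.sum_le_sum_of_subset_of_nonneg (Finset.range_subset_range.2 (by omega))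
      fun _ _ _ => abs_nonneg _
  rw [Finset.sum_range_add] at hmono
  nlinarith

/-- The deviation of the number of occurrences of `ℓ` in `w` from the expected `f * |w|`. -/
def discrepancy (f : ℝ) (ℓ : ℕ) (w : List ℕ) : ℝ := w.count ℓ - f * w.length

theorem discrepancy_append (f : ℝ) (ℓ : ℕ) (u v : List ℕ) :
    discrepancy f ℓ (u ++ v) = discrepancy f ℓ u + discrepancy f ℓ v := by
  simp only [discrepancy, List.count_append, List.length_append]
  push_cast
  ring

theorem sum_abs_discrepancy_lt {b : ℝ} (hlo : 0.54368901 < b) (hhi : b < 0.54368902)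
    (hb : b ^ 3 + b ^ 2 + b = 1) {ℓ : ℕ} (hℓ : ℓ < 3) (n : ℕ) :
    ∑ j ∈ Finset.range n, |discrepancy (b ^ (ℓ + 1)) ℓ (mbIter 3 j)| < 3 / 2 := by
  obtain ⟨d, hd⟩ : ∃ d : ℕ → ℝ, d = fun j => discrepancy (b ^ (ℓ + 1)) ℓ (mbIter 3 j) := ⟨_, rfl⟩
  have hrec (k : ℕ) : d (k + 3) = d (k + 2) + d (k + 1) + d k := by
    simp only [hd, mbIter_three_add_three, discrepancy_append]
  have i0 : mbIter 3 0 = [0] := by decide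
  have i1 : mbIter 3 1 = [0, 1] := by decide
  have i2 : mbIter 3 2 = [0, 1, 0, 2] := by decide
  have d0 : d 0 = discrepancy (b ^ (ℓ + 1)) ℓ [0] := by rw [hd, ← i0]
  have d1 : d 1 = discrepancy (b ^ (ℓ + 1)) ℓ [0, 1] := by rw [hd, ← i1]
  have d2 : d 2 = discrepancy (b ^ (ℓ + 1)) ℓ [0, 1, 0, 2] := by rw [hd, ← i2]
  have d3 := hrec 0
  have d4 := hrec 1
  have d5 := hrec 2
  have d6 := hrec 3
  have d7 := hrec 4
  have d8 := hrec 5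
  have d9 := hrec 6
  have d10 := hrec 7
  have d11 := hrec 8
  have hlo2 : 0.29559774 < b ^ 2 := by nlinarith
  have hhi2 : b ^ 2 < 0.29559775 := by nlinarith
  suffices d 2 + (b + b ^ 2) * d 1 + b * d 0 = 0 ∧
      ∑ j ∈ Finset.range 8, |d j| + 100 / 58 * ∑ j ∈ Finset.range 4, |d (8 + j)| < 3 / 2 by
    simpa only [hd] using
      sum_abs_lt_of_tribonacci_recurrence hlo hhi hb hrec this.1 this.2 n
  interval_cases ℓ
  · norm_num [discrepancy] at d0 d1 d2
    constructor
    · rw [d0, d1, d2]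
      grind
    simp only [Finset.sum_range_succ, Finset.sum_range_zero]
    have b0 : |d 0| ≤ 0.457 := by rw [abs_le]; constructor <;> linarith
    have b1 : |d 1| ≤ 0.088 := by rw [abs_le]; constructor <;> linarith
    have b2 : |d 2| ≤ 0.175 := by rw [abs_le]; constructor <;> linarith
    have b3 : |d 3| ≤ 0.195 := by rw [abs_le]; constructor <;> linarith
    have b4 : |d 4| ≤ 0.069 := by rw [abs_le]; constructor <;> linarith
    have b5 : |d 5| ≤ 0.049 := by rw [abs_le]; constructor <;> linarith
    have b6 : |d 6| ≤ 0.078 := by rw [abs_le]; constructor <;> linarith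
    have b7 : |d 7| ≤ 0.039 := by rw [abs_le]; constructor <;> linarith
    have b8 : |d 8| ≤ 0.010 := by rw [abs_le]; constructor <;> linarith
    have b9 : |d 9| ≤ 0.030 := by rw [abs_le]; constructor <;> linarith
    have b10 : |d 10| ≤ 0.020 := by rw [abs_le]; constructor <;> linarith
    have b11 : |d 11| ≤ 0.001 := by rw [abs_le]; constructor <;> linarith
    linarith
  · norm_num [discrepancy] at d0 d1 d2
    constructor
    · rw [d0, d1, d2]
      grind
    simp only [Finset.sum_range_succ, Finset.sum_range_zero]
    have b0 : |d 0| ≤ 0.296 := by rw [abs_le]; constructor <;> linarith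
    have b1 : |d 1| ≤ 0.409 := by rw [abs_le]; constructor <;> linarith
    have b2 : |d 2| ≤ 0.183 := by rw [abs_le]; constructor <;> linarith
    have b3 : |d 3| ≤ 0.070 := by rw [abs_le]; constructor <;> linarith
    have b4 : |d 4| ≤ 0.158 := by rw [abs_le]; constructor <;> linarith
    have b5 : |d 5| ≤ 0.095 := by rw [abs_le]; constructor <;> linarith
    have b6 : |d 6| ≤ 0.007 := by rw [abs_le]; constructor <;> linarith
    have b7 : |d 7| ≤ 0.057 := by rw [abs_le]; constructor <;> linarith
    have b8 : |d 8| ≤ 0.045 := by rw [abs_le]; constructor <;> linarith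
    have b9 : |d 9| ≤ 0.007 := by rw [abs_le]; constructor <;> linarith
    have b10 : |d 10| ≤ 0.019 := by rw [abs_le]; constructor <;> linarith
    have b11 : |d 11| ≤ 0.020 := by rw [abs_le]; constructor <;> linarith
    linarith
  · norm_num [discrepancy] at d0 d1 d2
    constructor
    · rw [d0, d1, d2]
      grind
    simp only [Finset.sum_range_succ, Finset.sum_range_zero]
    have b0 : |d 0| ≤ 0.161 := by rw [abs_le]; constructor <;> linarith
    have b1 : |d 1| ≤ 0.322 := by rw [abs_le]; constructor <;> linarith
    have b2 : |d 2| ≤ 0.358 := by rw [abs_le]; constructor <;> linarith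
    have b3 : |d 3| ≤ 0.126 := by rw [abs_le]; constructor <;> linarith
    have b4 : |d 4| ≤ 0.090 := by rw [abs_le]; constructor <;> linarith
    have b5 : |d 5| ≤ 0.143 := by rw [abs_le]; constructor <;> linarith
    have b6 : |d 6| ≤ 0.072 := by rw [abs_le]; constructor <;> linarith
    have b7 : |d 7| ≤ 0.018 := by rw [abs_le]; constructor <;> linarith
    have b8 : |d 8| ≤ 0.054 := by rw [abs_le]; constructor <;> linarith
    have b9 : |d 9| ≤ 0.036 := by rw [abs_le]; constructor <;> linarith
    have b10 : |d 10| ≤ 0.001 := by rw [abs_le]; constructor <;> linarith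
    have b11 : |d 11| ≤ 0.019 := by rw [abs_le]; constructor <;> linarith
    linarith

theorem tribonacci_two_balanced (ℓ : ℕ) (hℓ : ℓ < 3) (v w : List ℕ)
    (hv : mbFactor 3 v) (hw : mbFactor 3 w) (hlen : v.length = w.length) :
    |(v.count ℓ : ℤ) - (w.count ℓ : ℤ)| ≤ 2 := by
  obtain ⟨b, hlo, hhi, hb⟩ := exists_inv_tribonacci_root
  have hbound {u : List ℕ} (hu : mbFactor 3 u) : |discrepancy (b ^ (ℓ + 1)) ℓ u| < 3 / 2 := by
    obtain ⟨k, hk⟩ := hu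
    exact (abs_le_sum_abs_of_infix (discrepancy_append _ _) hk).trans_lt
      (sum_abs_discrepancy_lt hlo hhi hb hℓ _)
  have hv' := abs_lt.1 (hbound hv)
  have hw' := abs_lt.1 (hbound hw)
  simp only [discrepancy, hlen] at hv' hw'
  have h : |(v.count ℓ : ℝ) - (w.count ℓ : ℝ)| < 3 := by
    rw [abs_lt]; constructor <;> linarith
  have h' : |(v.count ℓ : ℤ) - (w.count ℓ : ℤ)| < 3 := by exact_mod_cast h
  omega
end

section
/- The sequence (ρ_t(n))_{n≥1} of abelian complexities of the Tribonacci word is T-automatic: there exists a deterministic finite automaton with output (Q, {0,1}, δ, q_0, {3,4,5,6,7}, τ) with at most 68 states such that for every n ≥ 1, ρ_t(n) = τ(δ(q_0, ⟨n⟩_T)), where the automaton reads the normal T-representation of n starting from the most significant digit. -/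
namespace TribonacciComplexity
/-! ### The Tribonacci word -/

lemma mbIter_zero : mbIter 3 0 = [0] := rfl

lemma mbIter_succ (k : ℕ) : mbIter 3 (k + 1) = mbApply 3 (mbIter 3 k) :=
  Function.iterate_succ_apply' _ _ _

lemma mbApply_append (x y : List ℕ) : mbApply 3 (x ++ y) = mbApply 3 x ++ mbApply 3 y :=
  List.flatMap_append

lemma mbApply_singleton (a : ℕ) : mbApply 3 [a] = mbSub 3 a := by simp [mbApply]

lemma mbApply_prefix {x y : List ℕ} (h : x <+: y) : mbApply 3 x <+: mbApply 3 y := by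
  obtain ⟨z, rfl⟩ := h
  exact ⟨mbApply 3 z, (mbApply_append x z).symm⟩

lemma mbIter_prefix_succ (k : ℕ) : mbIter 3 k <+: mbIter 3 (k + 1) := by
  induction k with
  | zero => exact ⟨[1], by decide⟩
  | succ k ih => rw [mbIter_succ k, mbIter_succ (k + 1)]; exact mbApply_prefix ih

lemma mbIter_prefix {k l : ℕ} (h : k ≤ l) : mbIter 3 k <+: mbIter 3 l := by
  induction l, h using Nat.le_induction with
  | base => exact List.prefix_rfl
  | succ l _ ih => exact ih.trans (mbIter_prefix_succ l)

lemma le_two_of_mem_mbSub {a b : ℕ} (ha : a ≤ 2) (hb : b ∈ mbSub 3 a) : b ≤ 2 := by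
  interval_cases a <;> simp [mbSub] at hb <;> omega

lemma le_two_of_mem_mbApply {x : List ℕ} (hx : ∀ a ∈ x, a ≤ 2) : ∀ a ∈ mbApply 3 x, a ≤ 2 := by
  intro b hb
  obtain ⟨a, ha, hb⟩ := List.mem_flatMap.1 hb
  exact le_two_of_mem_mbSub (hx a ha) hb

lemma le_two_of_mem_mbIter (k : ℕ) : ∀ a ∈ mbIter 3 k, a ≤ 2 := by
  induction k with
  | zero => simp [mbIter_zero]
  | succ k ih => rw [mbIter_succ]; exact le_two_of_mem_mbApply ih

lemma iterate_mbApply_append (k : ℕ) (x y : List ℕ) :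
    (mbApply 3)^[k] (x ++ y) = (mbApply 3)^[k] x ++ (mbApply 3)^[k] y := by
  induction k generalizing x y with
  | zero => rfl
  | succ k ih => simp only [Function.iterate_succ_apply, mbApply_append, ih]

lemma mbIter_add_three (k : ℕ) :
    mbIter 3 (k + 3) = mbIter 3 (k + 2) ++ mbIter 3 (k + 1) ++ mbIter 3 k := by
  have h (j : ℕ) : mbIter 3 (k + j) = (mbApply 3)^[k] (mbIter 3 j) :=
    Function.iterate_add_apply _ _ _ _
  have h3 : mbIter 3 3 = mbIter 3 2 ++ mbIter 3 1 ++ mbIter 3 0 := by decide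
  rw [h 3, h3, iterate_mbApply_append, iterate_mbApply_append, ← h, ← h, ← h, add_zero]

lemma length_mbIter (k : ℕ) : (mbIter 3 k).length = tribN (k + 3) := by
  induction k using Nat.strong_induction_on with
  | _ k ih =>
    match k with
    | 0 => decide
    | 1 => decide
    | 2 => decide
    | k + 3 =>
      rw [mbIter_add_three, List.length_append, List.length_append, ih k (by omega),
        ih (k + 1) (by omega), ih (k + 2) (by omega)]
      rfl

lemma lt_tribN (k : ℕ) : k < tribN (k + 3) := by
  induction k using Nat.strong_induction_on with
  | _ k ih =>
    match k with
    | 0 => decide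
    | 1 => decide
    | 2 => decide
    | k + 3 =>
      have h1 := ih (k + 2) (by omega)
      have h2 := ih (k + 1) (by omega)
      have h3 : tribN (k + 3 + 3) = tribN (k + 2 + 3) + tribN (k + 1 + 3) + tribN (k + 3) := rfl
      omega

/-! ### Prefixes of the Tribonacci word -/

/-- The word `x` followed by the letter `a` is a prefix of the Tribonacci word. -/
def IsPre (x : List ℕ) (a : ℕ) : Prop := ∃ k, x ++ [a] <+: mbIter 3 k

lemma IsPre.le_two {x : List ℕ} {a : ℕ} (h : IsPre x a) : a ≤ 2 ∧ ∀ b ∈ x, b ≤ 2 := by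
  obtain ⟨k, hk⟩ := h
  have := fun b hb => le_two_of_mem_mbIter k b (hk.subset hb)
  exact ⟨this a (by simp), fun b hb => this b (by simp [hb])⟩

lemma IsPre.prefix_or_prefix {x y : List ℕ} {a b : ℕ} (hx : IsPre x a) (hy : IsPre y b) :
    x ++ [a] <+: y ++ [b] ∨ y ++ [b] <+: x ++ [a] := by
  obtain ⟨k, hk⟩ := hx
  obtain ⟨l, hl⟩ := hy
  exact List.prefix_or_prefix_of_prefix (hk.trans (mbIter_prefix (le_max_left k l)))
    (hl.trans (mbIter_prefix (le_max_right k l)))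

lemma IsPre.prefix_of_length_lt {x y : List ℕ} {a b : ℕ} (hx : IsPre x a) (hy : IsPre y b)
    (h : x.length < y.length) : x ++ [a] <+: y := by
  rcases hx.prefix_or_prefix hy with h' | h'
  · exact List.prefix_of_prefix_length_le h' (List.prefix_append y [b]) (by simpa using h)
  · have := h'.length_le
    simp at this
    omega

lemma IsPre.prefix_of_length_le {x y : List ℕ} {a b : ℕ} (hx : IsPre x a) (hy : IsPre y b)
    (h : x.length ≤ y.length) : x <+: y := by
  rcases hx.prefix_or_prefix hy with h' | h'
  · exact List.prefix_of_prefix_length_le ((List.prefix_append x [a]).trans h')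
      (List.prefix_append y [b]) h
  · exact List.prefix_of_prefix_length_le (List.prefix_append x [a])
      ((List.prefix_append y [b]).trans h') h

lemma exists_isPre_append {x z : List ℕ} {k : ℕ} (h : x ++ z <+: mbIter 3 k) :
    ∃ a, IsPre x a := by
  have h1 : (mbIter 3 k) ++ [] <+: mbIter 3 (k + x.length + 1) := by
    simpa using mbIter_prefix (show k ≤ k + x.length + 1 by omega)
  have hx : x <+: mbIter 3 (k + x.length + 1) :=
    (List.prefix_append x z).trans (h.trans (by simpa using h1))
  obtain ⟨t, ht⟩ := hx
  have hlen := congrArg List.length ht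
  rw [List.length_append, length_mbIter] at hlen
  have := lt_tribN (k + x.length + 1)
  match t, ht with
  | [], ht => simp at hlen; omega
  | a :: t, ht => exact ⟨a, k + x.length + 1, t, by simpa using ht⟩

lemma exists_isPre_length (n : ℕ) : ∃ x a, x.length = n ∧ IsPre x a := by
  have h : (mbIter 3 n).take n ++ (mbIter 3 n).drop n <+: mbIter 3 n := by
    rw [List.take_append_drop]
  obtain ⟨a, ha⟩ := exists_isPre_append h
  refine ⟨_, a, ?_, ha⟩
  have := lt_tribN n
  rw [List.length_take, length_mbIter]
  omega

/-- The letters that can follow the image of a prefix followed by `a`, with the number of extra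
zeros read. -/
def letterKids (a : ℕ) : List (ℕ × ℕ) := if a < 2 then [(0, 0), (1, a + 1)] else [(0, 0)]

lemma IsPre.kid {x : List ℕ} {a : ℕ} (h : IsPre x a) {p : ℕ × ℕ} (hp : p ∈ letterKids a) :
    IsPre (mbApply 3 x ++ List.replicate p.1 0) p.2 := by
  have ha := h.le_two.1
  obtain ⟨k, hk⟩ := h
  refine ⟨k + 1, List.IsPrefix.trans ?_ (mbIter_succ k ▸ mbApply_prefix hk)⟩
  rw [mbApply_append, mbApply_singleton]
  interval_cases a <;> simp [letterKids, mbSub] at hp ⊢ <;>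
    rcases hp with rfl | rfl <;> simp

lemma exists_parent_of_prefix {x y : List ℕ} {a : ℕ} (hy : ∀ b ∈ y, b ≤ 2)
    (h : x ++ [a] <+: mbApply 3 y) :
    ∃ z b, z ++ [b] <+: y ∧ ∃ p ∈ letterKids b,
      x = mbApply 3 z ++ List.replicate p.1 0 ∧ a = p.2 := by
  induction y generalizing x with
  | nil => simp [mbApply] at h
  | cons c y ih =>
    have hc : c ≤ 2 := hy c (by simp)
    have ih' := fun x => @ih x (fun b hb => hy b (by simp [hb]))
    have hcons : mbApply 3 (c :: y) = mbSub 3 c ++ mbApply 3 y := rfl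
    rw [hcons] at h
    have lift : ∀ x', x = mbSub 3 c ++ x' → x' ++ [a] <+: mbApply 3 y → ∃ z b, z ++ [b] <+: c :: y ∧
        ∃ p ∈ letterKids b, x = mbApply 3 z ++ List.replicate p.1 0 ∧ a = p.2 := by
      intro x' hx hx'
      obtain ⟨z, b, hz, p, hp, h1, h2⟩ := ih' x' hx'
      exact ⟨c :: z, b, by simpa using hz, p, hp, by rw [hx, h1, ← List.append_assoc]; rfl, h2⟩
    match x with
    | [] =>
      refine ⟨[], c, by simp, (0, 0), ?_, rfl, ?_⟩
      · unfold letterKids; split <;> simp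
      · interval_cases c <;> simpa [mbSub] using h
    | [u] =>
      interval_cases c
      · refine ⟨[], 0, by simp, (1, 1), by decide, ?_⟩
        simpa [mbSub, mbApply] using h
      · refine ⟨[], 1, by simp, (1, 2), by decide, ?_⟩
        simpa [mbSub, mbApply] using h
      · simp [mbSub] at h
        exact lift [] (by simp [mbSub, h.1]) (by simpa using h.2)
    | u :: v :: x =>
      interval_cases c <;> simp [mbSub] at h
      · exact lift x (by simp [mbSub, h.1, h.2.1]) (by simpa using h.2.2)
      · exact lift x (by simp [mbSub, h.1, h.2.1]) (by simpa using h.2.2)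
      · exact lift (v :: x) (by simp [mbSub, h.1]) (by simpa using h.2)

lemma IsPre.exists_parent {x : List ℕ} {a : ℕ} (h : IsPre x a) :
    ∃ z b, IsPre z b ∧ ∃ p ∈ letterKids b, x = mbApply 3 z ++ List.replicate p.1 0 ∧ a = p.2 := by
  obtain ⟨k, hk⟩ := h
  have hk' := hk.trans (mbIter_prefix_succ k)
  rw [mbIter_succ] at hk'
  obtain ⟨z, b, hz, hp⟩ := exists_parent_of_prefix (le_two_of_mem_mbIter k) hk'
  exact ⟨z, b, ⟨k, hz⟩, hp⟩

/-! ### Letter counts -/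

/-- The Parikh vector of a word over the letters 0, 1, 2. -/
def psi (x : List ℕ) : ℤ × ℤ × ℤ := (x.count 0, x.count 1, x.count 2)

/-- The sum of the coordinates of a Parikh vector. -/
def total (v : ℤ × ℤ × ℤ) : ℤ := v.1 + v.2.1 + v.2.2

lemma total_sub (v w : ℤ × ℤ × ℤ) : total (v - w) = total v - total w := by
  simp only [total, Prod.fst_sub, Prod.snd_sub]; ring

lemma psi_append (x y : List ℕ) : psi (x ++ y) = psi x + psi y := by
  simp [psi]

lemma psi_cons (a : ℕ) (x : List ℕ) : psi (a :: x) = psi [a] + psi x :=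
  psi_append [a] x

lemma total_psi {x : List ℕ} (hx : ∀ a ∈ x, a ≤ 2) : total (psi x) = x.length := by
  induction x with
  | nil => rfl
  | cons a x ih =>
    have ha := hx a (by simp)
    have ih := ih fun b hb => hx b (by simp [hb])
    rw [psi_cons]
    simp only [total, psi, Prod.fst_add, Prod.snd_add] at ih ⊢
    interval_cases a <;> simp <;> linarith

lemma psi_mbApply {x : List ℕ} (hx : ∀ a ∈ x, a ≤ 2) :
    psi (mbApply 3 x) = (total (psi x), (psi x).1, (psi x).2.1) := by
  induction x with
  | nil => rfl
  | cons a x ih =>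
    have ha := hx a (by simp)
    have ih := ih fun b hb => hx b (by simp [hb])
    have hcons : mbApply 3 (a :: x) = mbSub 3 a ++ mbApply 3 x := rfl
    rw [hcons, psi_append, ih, psi_cons a x]
    interval_cases a <;> simp [mbSub, total, psi] <;> ring

lemma psi_kid {x : List ℕ} (hx : ∀ a ∈ x, a ≤ 2) (s : ℕ) :
    psi (mbApply 3 x ++ List.replicate s 0) =
      (total (psi x) + s, (psi x).1, (psi x).2.1) := by
  rw [psi_append, psi_mbApply hx]
  simp [psi, List.count_replicate]

lemma length_mbApply {x : List ℕ} (hx : ∀ a ∈ x, a ≤ 2) :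
    ((mbApply 3 x).length : ℤ) = 2 * x.length - (psi x).2.2 := by
  rw [← total_psi (le_two_of_mem_mbApply hx), psi_mbApply hx, ← total_psi hx]
  simp only [total]
  ring

lemma fst_le_one_of_mem_letterKids {a : ℕ} {p : ℕ × ℕ} (hp : p ∈ letterKids a) :
    p.1 ≤ 1 ∧ (p.1 = 1 → a < 2) := by
  unfold letterKids at hp
  split at hp <;> simp at hp
  · rcases hp with rfl | rfl <;> simp [*]
  · subst hp; simp

/-! ### Displacements -/

/-- A difference of Parikh vectors together with the letters following the two prefixes. -/
abbrev Disp := (ℤ × ℤ × ℤ) × ℕ × ℕ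

/-- The displacements, relative to the word `w`, of the pairs of prefixes of the Tribonacci word
whose lengths differ by `w.length + c` with `-1 ≤ c ≤ 3`. -/
def dispSet (w : List ℕ) : Set Disp :=
  {e | ∃ x y, IsPre x e.2.1 ∧ IsPre y e.2.2 ∧ e.1 = psi y - psi x - psi w ∧
    -1 ≤ total e.1 ∧ total e.1 ≤ 3}

/-- The displacements arising from `e` after one application of the substitution, when the digit
`d` is read. -/
def kids (d : ℕ) (e : Disp) : List Disp :=
  ((letterKids e.2.1).flatMap fun p => (letterKids e.2.2).map fun r =>
    ((total e.1 + r.1 - p.1 - d, e.1.1, e.1.2.1), p.2, r.2)).filter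
      fun f => -1 ≤ total f.1 ∧ total f.1 ≤ 3

lemma mem_kids {d : ℕ} {e f : Disp} : f ∈ kids d e ↔
    (∃ p ∈ letterKids e.2.1, ∃ r ∈ letterKids e.2.2,
      f = ((total e.1 + r.1 - p.1 - d, e.1.1, e.1.2.1), p.2, r.2)) ∧
    -1 ≤ total f.1 ∧ total f.1 ≤ 3 := by
  simp only [kids, List.mem_filter, List.mem_flatMap, List.mem_map, decide_eq_true_eq,
    eq_comm (a := f)]

lemma psi_kid_sub {w x y : List ℕ} (hw : ∀ a ∈ w, a ≤ 2) (hx : ∀ a ∈ x, a ≤ 2)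
    (hy : ∀ a ∈ y, a ≤ 2) (d p r : ℕ) :
    psi (mbApply 3 y ++ List.replicate r 0) - psi (mbApply 3 x ++ List.replicate p 0) -
        psi (mbApply 3 w ++ List.replicate d 0) =
      (total (psi y - psi x - psi w) + r - p - d, (psi y - psi x - psi w).1,
        (psi y - psi x - psi w).2.1) := by
  rw [psi_kid hw, psi_kid hx, psi_kid hy, total_sub, total_sub]
  ext <;> simp
  ring

lemma kids_subset_dispSet {w : List ℕ} (hw : ∀ a ∈ w, a ≤ 2) {d : ℕ} {e f : Disp}
    (he : e ∈ dispSet w) (hf : f ∈ kids d e) :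
    f ∈ dispSet (mbApply 3 w ++ List.replicate d 0) := by
  obtain ⟨x, y, hx, hy, hxy, -⟩ := he
  obtain ⟨⟨p, hp, r, hr, hfe⟩, hf⟩ := mem_kids.1 hf
  subst hfe
  refine ⟨_, _, hx.kid (p := p) hp, hy.kid (p := r) hr, ?_, hf⟩
  rw [psi_kid_sub hw hx.le_two.2 hy.le_two.2, hxy]

/-- A bound satisfied by all displacements that occur. -/
def Admissible (e : Disp) : Prop :=
  -1 ≤ e.1.2.2 ∧ (total e.1 = 3 → e.1.2.2 + (if e.2.2 = 2 then 1 else 0) ≤ 2)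

instance : DecidablePred Admissible := fun e => by unfold Admissible; infer_instance

/-- If all displacements of prefixes no longer than the given ones are admissible, a pair of
prefixes whose images differ in length by about the length of the image of `w` differ themselves
in length by about the length of `w`. -/
lemma parent_mem_window {w x y : List ℕ} {a b d : ℕ} {p r : ℕ × ℕ} (hw : ∀ a ∈ w, a ≤ 2)
    (hx : IsPre x a) (hy : IsPre y b) (hd : d ≤ 1) (hp : p ∈ letterKids a) (hr : r ∈ letterKids b)
    (hadm : ∀ z c, IsPre z c → z.length ≤ max (x.length + w.length) y.length →
      -1 ≤ total (psi z - psi x - psi w) → total (psi z - psi x - psi w) ≤ 3 →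
      Admissible (psi z - psi x - psi w, a, c))
    (h1 : -1 ≤ total (psi (mbApply 3 y ++ List.replicate r.1 0) -
      psi (mbApply 3 x ++ List.replicate p.1 0) - psi (mbApply 3 w ++ List.replicate d 0)))
    (h2 : total (psi (mbApply 3 y ++ List.replicate r.1 0) -
      psi (mbApply 3 x ++ List.replicate p.1 0) - psi (mbApply 3 w ++ List.replicate d 0)) ≤ 3) :
    -1 ≤ total (psi y - psi x - psi w) ∧ total (psi y - psi x - psi w) ≤ 3 := by
  have htot {z c} (hz : IsPre z c) :
      total (psi z - psi x - psi w) = z.length - x.length - w.length := by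
    rw [total_sub, total_sub, total_psi hz.le_two.2, total_psi hx.le_two.2, total_psi hw]
  have hp1 := fst_le_one_of_mem_letterKids hp
  have hr1 := fst_le_one_of_mem_letterKids hr
  have hlen : total (psi (mbApply 3 y ++ List.replicate r.1 0) -
      psi (mbApply 3 x ++ List.replicate p.1 0) - psi (mbApply 3 w ++ List.replicate d 0)) =
      (mbApply 3 y).length + r.1 - ((mbApply 3 x).length + p.1) - ((mbApply 3 w).length + d) := by
    rw [psi_kid_sub hw hx.le_two.2 hy.le_two.2, length_mbApply hw, length_mbApply hx.le_two.2,
      length_mbApply hy.le_two.2, ← total_psi hw, ← total_psi hx.le_two.2, ← total_psi hy.le_two.2]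
    simp only [total, Prod.fst_sub, Prod.snd_sub]
    ring
  rw [hlen] at h1 h2
  rw [htot hy]
  have hLw := length_mbApply hw
  have hLx := length_mbApply hx.le_two.2
  constructor
  · by_contra hlt
    obtain ⟨z, c, hz, hzc⟩ := exists_isPre_length (x.length + w.length - 1)
    have hyz := hy.prefix_of_length_lt hzc (by omega)
    have hzt := htot hzc
    have ha := (hadm z c hzc (by omega) (by omega) (by omega)).1
    simp only [Prod.snd_sub] at ha
    have hLz := length_mbApply hzc.le_two.2
    have hle := (mbApply_prefix hyz).length_le
    rw [mbApply_append, mbApply_singleton, List.length_append] at hle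
    have hb : r.1 + 1 ≤ (mbSub 3 b).length := by
      unfold mbSub
      split <;> simp <;> omega
    omega
  · by_contra hlt
    obtain ⟨k, hk⟩ := hy
    have hy : IsPre y b := ⟨k, hk⟩
    obtain ⟨c, hc⟩ : ∃ c, IsPre (y.take (x.length + w.length + 3)) c := by
      refine exists_isPre_append (z := y.drop (x.length + w.length + 3)) (k := k) ?_
      rw [List.take_append_drop]
      exact (List.prefix_append y [b]).trans hk
    set z := y.take (x.length + w.length + 3) with hz
    have hzl : z.length = x.length + w.length + 3 := by
      rw [hz, List.length_take]; omega
    have hzy := hc.prefix_of_length_lt hy (by omega)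
    have hzt := htot hc
    have ha := (hadm z c hc (by omega) (by omega) (by omega)).2 (by simp only; omega)
    simp only [Prod.snd_sub] at ha
    have hLz := length_mbApply hc.le_two.2
    have hle := (mbApply_prefix hzy).length_le
    rw [mbApply_append, mbApply_singleton, List.length_append] at hle
    have hb : (mbSub 3 c).length + (if c = 2 then 1 else 0) = 2 := by
      unfold mbSub
      split <;> simp [*]
    split_ifs at ha hb <;> omega

lemma exists_kids_of_mem_dispSet {w : List ℕ} (hw : ∀ a ∈ w, a ≤ 2) {d : ℕ} (hd : d ≤ 1)
    (hadm : ∀ e ∈ dispSet w, Admissible e) {f : Disp}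
    (hf : f ∈ dispSet (mbApply 3 w ++ List.replicate d 0)) : ∃ e ∈ dispSet w, f ∈ kids d e := by
  obtain ⟨v, a', b'⟩ := f
  obtain ⟨x', y', hx', hy', hv, h1, h2⟩ := hf
  obtain ⟨x, a, hx, p, hp, rfl, rfl⟩ := hx'.exists_parent
  obtain ⟨y, b, hy, r, hr, rfl, rfl⟩ := hy'.exists_parent
  dsimp only at hv h1 h2
  rw [hv] at h1 h2
  have hwin := parent_mem_window hw hx hy hd hp hr
    (fun z c hz _ l u => hadm _ ⟨x, z, hx, hz, rfl, l, u⟩) h1 h2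
  refine ⟨(psi y - psi x - psi w, a, b), ⟨x, y, hx, hy, rfl, hwin⟩, mem_kids.2 ⟨⟨p, hp, r, hr, ?_⟩,
    hv ▸ h1, hv ▸ h2⟩⟩
  rw [hv, psi_kid_sub hw hx.le_two.2 hy.le_two.2]

lemma IsPre.length_lt_of_kid {x : List ℕ} {a s : ℕ} (hx : IsPre x a) {N : ℕ}
    (h : (mbApply 3 x ++ List.replicate s 0).length ≤ N + 1) : x.length ≤ N := by
  have hl := length_mbApply hx.le_two.2
  have ht := total_psi hx.le_two.2
  simp only [total, psi] at hl ht
  rw [List.length_append, List.length_replicate] at h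
  rcases Nat.eq_zero_or_pos x.length with h0 | h0
  · omega
  · have h0' : IsPre [] 0 := ⟨0, by simp [mbIter_zero]⟩
    have := List.count_pos_iff.2 ((h0'.prefix_of_length_lt hx h0).subset (by simp : 0 ∈ [] ++ [0]))
    omega

/-- A set of admissible displacements that contains the trivial one and is closed under the
substitution contains all displacements relative to the empty word. -/
lemma dispSet_nil_subset {A : Set Disp} (hA : ∀ e ∈ A, Admissible e)
    (h0 : ((0, 0, 0), 0, 0) ∈ A) (hkids : ∀ e ∈ A, ∀ f ∈ kids 0 e, f ∈ A) : dispSet [] ⊆ A := by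
  have key (N : ℕ) : ∀ x y a b, IsPre x a → IsPre y b → x.length ≤ N → y.length ≤ N →
      -1 ≤ total (psi y - psi x - psi []) → total (psi y - psi x - psi []) ≤ 3 →
      (psi y - psi x - psi [], a, b) ∈ A := by
    induction N with
    | zero =>
      intro x y a b hx hy hxl hyl _ _
      obtain rfl := List.length_eq_zero_iff.1 (Nat.le_zero.1 hxl)
      obtain rfl := List.length_eq_zero_iff.1 (Nat.le_zero.1 hyl)
      have hnil {c : ℕ} (hc : IsPre [] c) : c = 0 := by
        have h0' : IsPre [] 0 := ⟨0, by simp [mbIter_zero]⟩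
        rcases hc.prefix_or_prefix h0' with h | h <;> simpa [eq_comm] using h
      rw [hnil hx, hnil hy]
      exact h0
    | succ N ih =>
      intro x' y' a' b' hx' hy' hxl hyl h1 h2
      obtain ⟨x, a, hx, p, hp, rfl, rfl⟩ := hx'.exists_parent
      obtain ⟨y, b, hy, r, hr, rfl, rfl⟩ := hy'.exists_parent
      have hxN := hx.length_lt_of_kid hxl
      have hyN := hy.length_lt_of_kid hyl
      have hw : ∀ a ∈ ([] : List ℕ), a ≤ 2 := by simp
      have hwin := parent_mem_window (d := 0) hw hx hy zero_le_one hp hr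
        (fun z c hz hzl l u => hA _ (ih x z a c hx hz hxN (by simp at hzl; omega) l u)) h1 h2
      refine hkids _ (ih x y a b hx hy hxN hyN hwin.1 hwin.2) _
        (mem_kids.2 ⟨⟨p, hp, r, hr, ?_⟩, h1, h2⟩)
      have := psi_kid_sub hw hx.le_two.2 hy.le_two.2 0 p.1 r.1
      exact Prod.ext this rfl
  rintro ⟨v, a, b⟩ ⟨x, y, hx, hy, hv, h1, h2⟩
  dsimp only at hv h1 h2
  subst hv
  exact key (max x.length y.length) x y a b hx hy (le_max_left _ _) (le_max_right _ _) h1 h2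

/-! ### Words of digit strings -/

/-- The image of `w` followed by `d` zeros. -/
def digitStep (w : List ℕ) (d : ℕ) : List ℕ := mbApply 3 w ++ List.replicate d 0

/-- The word built from a digit string, most significant digit first. -/
def digitWord (L : List ℕ) : List ℕ := L.foldl digitStep []

lemma digitWord_concat (L : List ℕ) (d : ℕ) :
    digitWord (L ++ [d]) = digitStep (digitWord L) d := by
  simp [digitWord]

lemma le_two_of_mem_digitWord (L : List ℕ) : ∀ a ∈ digitWord L, a ≤ 2 := by
  induction L using List.reverseRecOn with
  | nil => simp [digitWord]
  | append_singleton L d ih =>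
    intro a ha
    rw [digitWord_concat, digitStep, List.mem_append, List.mem_replicate] at ha
    rcases ha with ha | ⟨-, rfl⟩
    · exact le_two_of_mem_mbApply ih a ha
    · exact Nat.zero_le _

lemma length_iterate_replicate (k d : ℕ) :
    ((mbApply 3)^[k] (List.replicate d 0)).length = d * tribN (k + 3) := by
  induction d with
  | zero =>
    have : (mbApply 3)^[k] [] = [] := Function.iterate_fixed rfl k
    simp [this]
  | succ d ih =>
    have h : List.replicate (d + 1) 0 = [0] ++ List.replicate d 0 := rfl
    rw [h, iterate_mbApply_append, List.length_append, ih, ← length_mbIter, mbIter]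
    ring

lemma length_foldl_digitStep (L w : List ℕ) :
    (L.foldl digitStep w).length = ((mbApply 3)^[L.length] w).length + valT L := by
  induction L generalizing w with
  | nil => rfl
  | cons d L ih =>
    rw [List.foldl_cons, ih, digitStep, iterate_mbApply_append, List.length_append,
      length_iterate_replicate, valT, List.length_cons, Function.iterate_succ_apply, add_assoc]

lemma length_digitWord (L : List ℕ) : (digitWord L).length = valT L := by
  have : (mbApply 3)^[L.length] [] = [] := Function.iterate_fixed rfl _
  rw [digitWord, length_foldl_digitStep, this, List.length_nil, zero_add]

lemma not_infix_of_isNormalTRep {n : ℕ} {L : List ℕ} (h : IsNormalTRep n L) :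
    ¬ [1, 1, 1] <:+: L := by
  rintro ⟨s, t, rfl⟩
  have := h.2.2.2 ([1, 1, 1] ++ t) ⟨s, by simp⟩
  have h3 : tribN (t.length + 3 + 3) =
    tribN (t.length + 2 + 3) + tribN (t.length + 1 + 3) + tribN (t.length + 3) := rfl
  simp only [List.cons_append, List.nil_append, valT, List.length_cons] at this
  rw [show t.length + 1 + 1 + 1 + 3 = t.length + 3 + 3 by ring] at this
  rw [show t.length + 1 + 1 + 3 = t.length + 2 + 3 by ring] at this
  omega

/-! ### Abelian complexity in terms of displacements -/

lemma mbAC_length {w : List ℕ} (hw : ∀ a ∈ w, a ≤ 2) :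
    mbAC 3 w.length = {v | total v = 0 ∧ ∃ a b, (v, a, b) ∈ dispSet w}.ncard := by
  have hfac {u : List ℕ} (hu : mbFactor 3 u) : ∀ a ∈ u, a ≤ 2 := fun a ha =>
    hu.elim fun k hk => le_two_of_mem_mbIter k a (hk.subset ha)
  let g : (ℕ → ℕ) → ℤ × ℤ × ℤ := fun f => ((f 0 : ℤ), (f 1 : ℤ), (f 2 : ℤ)) - psi w
  have hinj : Set.InjOn g ((fun (u : List ℕ) (l : ℕ) => u.count l) ''
      {u : List ℕ | mbFactor 3 u ∧ u.length = w.length}) := by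
    rintro _ ⟨u, hu, rfl⟩ _ ⟨u', hu', rfl⟩ h
    have h := sub_left_injective h
    simp only [Prod.mk.injEq, Nat.cast_inj] at h
    funext l
    rcases lt_or_ge 2 l with hl | hl
    · have h0 {u : List ℕ} (hu : mbFactor 3 u) : u.count l = 0 :=
        List.count_eq_zero.2 fun hm => absurd (hfac hu l hm) (by omega)
      simp only [h0 hu.1, h0 hu'.1]
    · interval_cases l
      exacts [h.1, h.2.1, h.2.2]
  rw [mbAC, ← hinj.ncard_image]
  congr 1
  ext v
  constructor
  · rintro ⟨_, ⟨u, ⟨hu, hlen⟩, rfl⟩, rfl⟩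
    have hul := hfac hu
    obtain ⟨k, s, t, hk⟩ := hu
    have hg : g (fun l => u.count l) = psi (s ++ u) - psi s - psi w := by
      rw [psi_append, add_sub_cancel_left]; rfl
    have htot : total (g fun l => u.count l) = 0 := by
      change total (psi u - psi w) = 0
      rw [total_sub, total_psi hul, total_psi hw, hlen, sub_self]
    obtain ⟨a, ha⟩ : ∃ a, IsPre s a :=
      exists_isPre_append (z := u ++ t) (k := k) (by rw [← hk, List.append_assoc])
    obtain ⟨b, hb⟩ : ∃ b, IsPre (s ++ u) b :=
      exists_isPre_append (z := t) (k := k) (by rw [← hk])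
    exact ⟨htot, a, b, s, s ++ u, ha, hb, hg, by simp only [htot]; decide,
      by simp only [htot]; decide⟩
  · rintro ⟨htot, a, b, x, y, hx, hy, hv, -⟩
    dsimp only at hx hy hv
    subst hv
    rw [total_sub, total_sub, total_psi hx.le_two.2, total_psi hy.le_two.2, total_psi hw] at htot
    obtain ⟨u, rfl⟩ := hx.prefix_of_length_le hy (by omega)
    rw [List.length_append] at htot
    obtain ⟨k, hk⟩ := hy
    refine ⟨_, ⟨u, ⟨⟨k, ?_⟩, by omega⟩, rfl⟩, ?_⟩
    · exact List.IsInfix.trans ⟨x, [b], rfl⟩ hk.isInfix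
    · rw [psi_append, add_sub_cancel_left]; rfl

/-! ### Sets of displacements as bit masks -/

/-- The code of a displacement as a natural number below 1080. -/
def encode (e : Disp) : ℕ :=
  ((e.1.1 + 2) * 180 + (e.1.2.1 + 2) * 36 + (e.1.2.2 + 1) * 9 + e.2.1 * 3 + e.2.2).toNat

def decodeVec (i : ℕ) : ℤ × ℤ × ℤ :=
  (((i / 20 : ℕ) : ℤ) - 2, ((i / 4 % 5 : ℕ) : ℤ) - 2, ((i % 4 : ℕ) : ℤ) - 1)

/-- The displacement with a given code. -/
def decode (c : ℕ) : Disp := (decodeVec (c / 9), c / 3 % 3, c % 3)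

/-- The bit of `m` at position `c`, in terms of operations the kernel evaluates natively. -/
def bit (m c : ℕ) : Bool := Nat.beq (Nat.land (Nat.shiftRight m c) 1) 1

/-- The mask of a set of codes containing those of all displacements that occur. -/
def univMask : ℕ :=
  0x6000000c0000000000000000000000000002d00003fe370075f2e0601008040000000000000002fa2d007fffe3f6dffffe3741a1d0e0600000000000120d229247e7fe3f6cfffff3f61f5fae0000008000000000100800122f23d247e7fe0060f7c0000000000000000000000000009000001200000200000000000000000

def univCodes : List ℕ := (List.range 1080).filter (bit univMask)

def maskOf (l : List ℕ) : ℕ := l.foldr (fun c m => m ||| 1 <<< c) 0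

/-- For every code, the mask of the displacements arising from it when reading the digit `d`. -/
def rows (d : ℕ) : List (ℕ × ℕ) :=
  univCodes.map fun c => (c, maskOf ((kids d (decode c)).map encode))

def orRows (m : ℕ) : List (ℕ × ℕ) → ℕ → ℕ
  | [], acc => acc
  | r :: rs, acc => orRows m rs (Nat.lor acc (Nat.mul (Nat.land (Nat.shiftRight m r.1) 1) r.2))

/-- The union of the rows indexed by the elements of `m`. -/
def next (rs : List (ℕ × ℕ)) (m : ℕ) : ℕ := orRows m rs 0

lemma land_shiftRight_one (m c : ℕ) : Nat.land (Nat.shiftRight m c) 1 = (m.testBit c).toNat := by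
  rw [Nat.toNat_testBit, ← Nat.shiftRight_eq_div_pow]
  exact Nat.and_one_is_mod _

lemma bit_eq_testBit (m c : ℕ) : bit m c = m.testBit c := by
  rw [bit, land_shiftRight_one]
  cases m.testBit c <;> rfl

lemma univMask_lt : univMask < 2 ^ 1080 := by decide +kernel

set_option exponentiation.threshold 1080 in
lemma lt_of_testBit_univMask {c : ℕ} (hc : univMask.testBit c) : c < 1080 := by
  by_contra! h
  have := Nat.testBit_lt_two_pow (univMask_lt.trans_le (Nat.pow_le_pow_right two_pos h))
  rw [this] at hc
  exact Bool.false_ne_true hc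

lemma mem_univCodes {c : ℕ} : c ∈ univCodes ↔ univMask.testBit c := by
  rw [univCodes, List.mem_filter, bit_eq_testBit, List.mem_range]
  exact ⟨fun h => h.2, fun h => ⟨lt_of_testBit_univMask h, h⟩⟩

lemma testBit_maskOf (l : List ℕ) (c : ℕ) : (maskOf l).testBit c ↔ c ∈ l := by
  induction l with
  | nil => simp [maskOf]
  | cons a l ih =>
    have h : maskOf (a :: l) = maskOf l ||| 1 <<< a := rfl
    rw [h, Nat.testBit_or, Bool.or_eq_true, ih, Nat.one_shiftLeft, Nat.testBit_two_pow,
      List.mem_cons, or_comm, decide_eq_true_eq, eq_comm]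

lemma testBit_orRows (m : ℕ) (rs : List (ℕ × ℕ)) (acc c : ℕ) : (orRows m rs acc).testBit c ↔
    acc.testBit c ∨ ∃ r ∈ rs, m.testBit r.1 ∧ r.2.testBit c := by
  induction rs generalizing acc with
  | nil => simp [orRows]
  | cons r rs ih =>
    have h : (Nat.lor acc (Nat.mul (Nat.land (Nat.shiftRight m r.1) 1) r.2)).testBit c ↔
        acc.testBit c ∨ m.testBit r.1 ∧ r.2.testBit c := by
      rw [land_shiftRight_one]
      change (acc ||| (m.testBit r.1).toNat * r.2).testBit c ↔ _
      rw [Nat.testBit_or, Bool.or_eq_true]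
      cases m.testBit r.1 <;> simp
    rw [orRows, ih, h, List.exists_mem_cons_iff, or_assoc]

lemma testBit_next_rows {m d c : ℕ} : (next (rows d) m).testBit c ↔
    ∃ b, univMask.testBit b ∧ m.testBit b ∧ ∃ e ∈ kids d (decode b), encode e = c := by
  simp [next, testBit_orRows, rows, testBit_maskOf, mem_univCodes]

/-- The set of displacements represented by a mask. -/
def sem (m : ℕ) : Set Disp := {e | ∃ c, m.testBit c ∧ decode c = e}

lemma admissible_decode {c : ℕ} (hc : univMask.testBit c) : Admissible (decode c) := by
  have h : (univCodes.all fun c => Admissible (decode c)) = true := by decide +kernel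
  simpa using List.all_eq_true.1 h c (mem_univCodes.2 hc)

lemma testBit_encode_of_mem_kids {c d : ℕ} (hc : univMask.testBit c) (hd : d ≤ 1) {e : Disp}
    (he : e ∈ kids d (decode c)) : univMask.testBit (encode e) ∧ decode (encode e) = e := by
  have h : (univCodes.all fun c => [0, 1].all fun d => (kids d (decode c)).all fun e =>
      bit univMask (encode e) && decide (decode (encode e) = e)) = true := by decide +kernel
  have h := List.all_eq_true.1 h c (mem_univCodes.2 hc)
  have h := List.all_eq_true.1 h d (by simp; omega)
  have h := List.all_eq_true.1 h e he
  rwa [Bool.and_eq_true, bit_eq_testBit, decide_eq_true_eq] at h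

lemma testBit_univMask_of_next {m d c : ℕ} (hd : d ≤ 1) (hc : (next (rows d) m).testBit c) :
    univMask.testBit c := by
  obtain ⟨b, hb, -, e, he, rfl⟩ := testBit_next_rows.1 hc
  exact (testBit_encode_of_mem_kids hb hd he).1

lemma mem_sem_next {m d : ℕ} (hm : ∀ c, m.testBit c → univMask.testBit c) (hd : d ≤ 1) {f : Disp} :
    f ∈ sem (next (rows d) m) ↔ ∃ e ∈ sem m, f ∈ kids d e := by
  constructor
  · rintro ⟨c, hc, rfl⟩
    obtain ⟨b, hb, hbm, e, he, rfl⟩ := testBit_next_rows.1 hc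
    exact ⟨decode b, ⟨b, hbm, rfl⟩, by rwa [(testBit_encode_of_mem_kids hb hd he).2]⟩
  · rintro ⟨_, ⟨b, hb, rfl⟩, hf⟩
    exact ⟨encode f, testBit_next_rows.2 ⟨b, hm b hb, hb, f, hf, rfl⟩,
      (testBit_encode_of_mem_kids (hm b hb) hd hf).2⟩

/-- The mask `m` represents the displacements relative to the word `w`. -/
def Represents (m : ℕ) (w : List ℕ) : Prop :=
  (∀ c, m.testBit c → univMask.testBit c) ∧ sem m = dispSet w

lemma admissible_of_mem_sem {m : ℕ} (hm : ∀ c, m.testBit c → univMask.testBit c) {e : Disp}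
    (he : e ∈ sem m) : Admissible e := by
  obtain ⟨c, hc, rfl⟩ := he
  exact admissible_decode (hm c hc)

lemma Represents.step {m d : ℕ} {w : List ℕ} (h : Represents m w) (hw : ∀ a ∈ w, a ≤ 2)
    (hd : d ≤ 1) : Represents (next (rows d) m) (digitStep w d) := by
  refine ⟨fun c hc => testBit_univMask_of_next hd hc, Set.ext fun f => ?_⟩
  rw [mem_sem_next h.1 hd, h.2]
  constructor
  · rintro ⟨e, he, hf⟩
    exact kids_subset_dispSet hw he hf
  · exact exists_kids_of_mem_dispSet hw hd fun e he => admissible_of_mem_sem h.1 (h.2 ▸ he)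

/-- The code of the trivial displacement. -/
def zeroCode : ℕ := encode ((0, 0, 0), 0, 0)

lemma decode_zeroCode : decode zeroCode = ((0, 0, 0), 0, 0) := by decide

lemma zero_mem_dispSet_nil : ((0, 0, 0), 0, 0) ∈ dispSet [] :=
  have h : IsPre [] 0 := ⟨0, by simp [mbIter_zero]⟩
  ⟨[], [], h, h, rfl, by decide, by decide⟩

/-- The mask of the displacements generated by the trivial one when reading zeros. -/
def initMask (r₀ : List (ℕ × ℕ)) : ℕ := (next r₀)^[12] (1 <<< zeroCode)

lemma represents_initMask (h : next (rows 0) (initMask (rows 0)) = initMask (rows 0)) :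
    Represents (initMask (rows 0)) [] := by
  have key (k : ℕ) : (∀ c, ((next (rows 0))^[k] (1 <<< zeroCode)).testBit c →
      univMask.testBit c) ∧
      ((0, 0, 0), 0, 0) ∈ sem ((next (rows 0))^[k] (1 <<< zeroCode)) ∧
      sem ((next (rows 0))^[k] (1 <<< zeroCode)) ⊆ dispSet [] := by
    induction k with
    | zero =>
      have hbit {c : ℕ} : (1 <<< zeroCode).testBit c ↔ zeroCode = c := by
        rw [Nat.one_shiftLeft, Nat.testBit_two_pow, decide_eq_true_eq]
      refine ⟨fun c hc => ?_, ⟨zeroCode, hbit.2 rfl, decode_zeroCode⟩, ?_⟩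
      · obtain rfl := hbit.1 hc
        decide +kernel
      · rintro _ ⟨c, hc, rfl⟩
        obtain rfl := hbit.1 hc
        rw [decode_zeroCode]
        exact zero_mem_dispSet_nil
    | succ k ih =>
      rw [Function.iterate_succ_apply']
      refine ⟨fun c hc => testBit_univMask_of_next zero_le_one hc, ?_, ?_⟩
      · exact (mem_sem_next ih.1 zero_le_one).2 ⟨_, ih.2.1, by decide⟩
      · intro f hf
        obtain ⟨e, he, hf⟩ := (mem_sem_next ih.1 zero_le_one).1 hf
        exact kids_subset_dispSet (by simp) (ih.2.2 he) hf
  refine ⟨(key 12).1, (key 12).2.2.antisymm ?_⟩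
  refine dispSet_nil_subset (fun e he => admissible_of_mem_sem (key 12).1 he) (key 12).2.1 ?_
  intro e he f hf
  have := (mem_sem_next (key 12).1 zero_le_one).2 ⟨e, he, hf⟩
  rwa [← initMask, h] at this

/-! ### Counting balanced displacements -/

/-- The codes of the vectors with coordinate sum zero that occur in displacements. -/
def balancedCodes : List ℕ :=
  (List.range 120).filter fun i =>
    total (decodeVec i) = 0 ∧ (List.range 9).any fun j => bit univMask (9 * i + j)

/-- The number of elements of `zs` that occur in displacements represented by `m`. -/
def numBalanced (zs : List ℕ) (m : ℕ) : ℕ :=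
  (zs.filter fun i => (List.range 9).any fun j => bit m (9 * i + j)).length

lemma decodeVec_injective : Function.Injective decodeVec := by
  intro i j h
  simp only [decodeVec, Prod.mk.injEq] at h
  omega

lemma any_bit {m i : ℕ} : ((List.range 9).any fun j => bit m (9 * i + j)) = true ↔
    ∃ c, m.testBit c ∧ c / 9 = i := by
  simp only [List.any_eq_true, List.mem_range, bit_eq_testBit]
  constructor
  · rintro ⟨j, hj, h⟩
    exact ⟨_, h, by omega⟩
  · rintro ⟨c, hc, rfl⟩
    exact ⟨c % 9, by omega, by rwa [Nat.div_add_mod]⟩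

lemma numBalanced_balancedCodes {m : ℕ} (hm : ∀ c, m.testBit c → univMask.testBit c) :
    numBalanced balancedCodes m = {v | total v = 0 ∧ ∃ a b, (v, a, b) ∈ sem m}.ncard := by
  have hset : {v | total v = 0 ∧ ∃ a b, (v, a, b) ∈ sem m} = decodeVec ''
      ((balancedCodes.filter fun i => (List.range 9).any fun j => bit m (9 * i + j)).toFinset :
        Set ℕ) := by
    ext v
    simp only [List.coe_toFinset, Set.mem_image, Set.mem_ofPred_eq, List.mem_filter, any_bit,
      balancedCodes, decide_eq_true_eq, List.mem_range]
    constructor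
    · rintro ⟨hv, a, b, c, hc, hcv⟩
      have hcv : decodeVec (c / 9) = v := congrArg Prod.fst hcv
      have := lt_of_testBit_univMask (hm c hc)
      exact ⟨c / 9, ⟨⟨by omega, hcv ▸ hv, c, hm c hc, rfl⟩, c, hc, rfl⟩, hcv⟩
    · rintro ⟨_, ⟨⟨-, hv, -⟩, c, hc, rfl⟩, rfl⟩
      exact ⟨hv, _, _, c, hc, rfl⟩
  rw [hset, Set.ncard_image_of_injective _ decodeVec_injective, Set.ncard_coe_finset,
    List.toFinset_card_of_nodup, numBalanced]
  exact (List.nodup_range.filter _).filter _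

/-! ### The automaton -/

/-- Evaluates `n` before passing it to `k`. -/
def withNat {α : Type} (n : ℕ) (k : ℕ → α) : α :=
  match n with
  | 0 => k 0
  | i + 1 => k (Nat.succ i)

def withRows {α : Type} : List (ℕ × ℕ) → (List (ℕ × ℕ) → α) → α
  | [], k => k []
  | r :: rs, k => withNat r.1 fun c => withNat r.2 fun m => withRows rs fun l => k ((c, m) :: l)

def withList {α : Type} : List ℕ → (List ℕ → α) → α
  | [], k => k []
  | r :: rs, k => withNat r fun c => withList rs fun l => k (c :: l)

lemma withNat_eq {α : Type} (n : ℕ) (k : ℕ → α) : withNat n k = k n := by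
  cases n <;> rfl

lemma withRows_eq {α : Type} (l : List (ℕ × ℕ)) (k : List (ℕ × ℕ) → α) : withRows l k = k l := by
  induction l generalizing k with
  | nil => rfl
  | cons r l ih => simp only [withRows, withNat_eq, ih]

lemma withList_eq {α : Type} (l : List ℕ) (k : List ℕ → α) : withList l k = k l := by
  induction l generalizing k with
  | nil => rfl
  | cons r l ih => simp only [withList, withNat_eq, ih]

/-- For every state, the successors under the digits 0 and 1 and the output. -/
def table : List (ℕ × ℕ × ℕ) :=
  [(1, 2, 5), (3, 4, 5), (5, 6, 3), (7, 8, 5), (9, 10, 4), (11, 12, 3), (13, 6, 4), (14, 15, 5),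
   (16, 17, 4), (18, 19, 4), (20, 0, 5), (6, 21, 3), (22, 8, 4), (23, 12, 4), (24, 25, 5),
   (26, 8, 5), (23, 27, 4), (28, 15, 4), (15, 29, 4), (7, 30, 5), (3, 31, 5), (32, 17, 3),
   (33, 12, 4), (17, 8, 4), (34, 8, 6), (35, 36, 4), (37, 12, 5), (22, 30, 4), (3, 25, 5),
   (9, 0, 4), (38, 7, 4), (9, 39, 4), (11, 27, 3), (15, 40, 4), (41, 15, 6), (33, 27, 4),
   (42, 0, 4), (43, 44, 5), (45, 46, 4), (47, 0, 5), (35, 17, 4), (48, 49, 6), (3, 50, 5),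
   (51, 49, 5), (52, 17, 5), (17, 30, 4), (53, 54, 5), (19, 55, 5), (56, 49, 6), (52, 36, 5),
   (35, 57, 4), (58, 25, 6), (37, 27, 5), (18, 3, 5), (59, 0, 5), (60, 39, 5), (56, 49, 7),
   (47, 0, 4), (61, 44, 6), (45, 62, 4), (18, 19, 5), (63, 49, 6), (53, 64, 5), (65, 25, 6),
   (66, 0, 5), (56, 44, 7), (45, 55, 4)]

def delta (q d : ℕ) : ℕ :=
  let r := table.getD q (0, 0, 3)
  (if d = 0 then r.1 else r.2.1) % 67

def output (q : ℕ) : ℕ := (table.getD q (0, 0, 3)).2.2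

/-- Packs a mask, the number of trailing ones of the digit string (or 3 if it is empty) and the
state of the automaton. -/
def pack (m e q : ℕ) : ℕ := (m * 4 + e) * 67 + q

def succs (r₀ r₁ : List (ℕ × ℕ)) (s : ℕ) : List ℕ :=
  let m := s / 67 / 4
  let e := s / 67 % 4
  let q := s % 67
  (bif Nat.beq e 3 then [] else [pack (next r₀ m) 0 (delta q 0)]) ++
  (bif Nat.beq e 2 then [] else [pack (next r₁ m) (bif Nat.beq e 3 then 1 else e + 1) (delta q 1)])

def goodState (zs : List ℕ) (s : ℕ) : Bool :=
  Nat.beq (s / 67 % 4) 3 || Nat.beq (numBalanced zs (s / 67 / 4)) (output (s % 67))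

def mem (s : ℕ) : List ℕ → Bool
  | [] => false
  | a :: l => bif Nat.beq s a then true else mem s l

/-- Explores the states reachable from `todo`, checking that they are all good. -/
def explore (succ : ℕ → List ℕ) (good : ℕ → Bool) : ℕ → List ℕ → List ℕ → Bool
  | 0, _, _ => false
  | _ + 1, [], _ => true
  | n + 1, s :: todo, seen =>
    bif mem s seen then explore succ good n todo seen
    else good s && withList (succ s ++ todo) fun t => explore succ good n t (s :: seen)

lemma mem_iff {s : ℕ} {l : List ℕ} : mem s l = true ↔ s ∈ l := by
  induction l with
  | nil => simp [mem]
  | cons a l ih =>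
    rw [mem, List.mem_cons, ← ih, Bool.cond_eq_ite]
    split_ifs with h <;> rw [Nat.beq_eq] at h <;> simp [h]

lemma exists_closed_of_explore {succ : ℕ → List ℕ} {good : ℕ → Bool} {n : ℕ} {todo seen : List ℕ}
    (h : explore succ good n todo seen = true)
    (hseen : ∀ s ∈ seen, good s = true ∧ ∀ t ∈ succ s, t ∈ seen ∨ t ∈ todo) :
    ∃ R : Set ℕ, (∀ s ∈ todo, s ∈ R) ∧ ∀ s ∈ R, good s = true ∧ ∀ t ∈ succ s, t ∈ R := by
  suffices ∃ R : Set ℕ, (∀ s ∈ seen, s ∈ R) ∧ (∀ s ∈ todo, s ∈ R) ∧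
      ∀ s ∈ R, good s = true ∧ ∀ t ∈ succ s, t ∈ R from this.imp fun _ h => h.2
  induction n generalizing todo seen with
  | zero => simp [explore] at h
  | succ n ih =>
    cases todo with
    | nil =>
      refine ⟨{s | s ∈ seen}, fun s hs => hs, by simp, fun s hs => ?_⟩
      exact ⟨(hseen s hs).1, fun t ht => by simpa using (hseen s hs).2 t ht⟩
    | cons s todo =>
      rw [explore, Bool.cond_eq_ite] at h
      split_ifs at h with hs
      · rw [mem_iff] at hs
        obtain ⟨R, h1, h2, h3⟩ := ih h fun u hu => ⟨(hseen u hu).1, fun t ht => by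
          rcases (hseen u hu).2 t ht with h | h
          · exact .inl h
          · rcases List.mem_cons.1 h with rfl | h
            exacts [.inl hs, .inr h]⟩
        exact ⟨R, h1, by simpa using ⟨h1 s hs, h2⟩, h3⟩
      · rw [withList_eq, Bool.and_eq_true] at h
        obtain ⟨R, h1, h2, h3⟩ := ih h.2 (by
          intro u hu
          rcases List.mem_cons.1 hu with rfl | hu
          · exact ⟨h.1, fun t ht => by simp [ht]⟩
          · refine ⟨(hseen u hu).1, fun t ht => ?_⟩
            have := (hseen u hu).2 t ht
            simp only [List.mem_cons, List.mem_append] at this ⊢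
            tauto)
        simp only [List.mem_cons, List.mem_append, forall_eq_or_imp] at h1 h2
        refine ⟨R, h1.2, ?_, h3⟩
        simpa using ⟨h1.1, fun t ht => h2 t (.inr ht)⟩

/-- The verification that the automaton outputs the number of balanced displacements. -/
def certificate : Bool :=
  withRows (rows 0) fun r₀ => withRows (rows 1) fun r₁ => withList balancedCodes fun zs =>
    withNat (initMask r₀) fun m =>
      Nat.beq (next r₀ m) m && explore (succs r₀ r₁) (goodState zs) 2000 [pack m 3 0] []

lemma certificate_eq_true : certificate = true := by decide +kernel

lemma next_initMask : next (rows 0) (initMask (rows 0)) = initMask (rows 0) := by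
  have h := certificate_eq_true
  simp only [certificate, withRows_eq, withList_eq, withNat_eq, Bool.and_eq_true] at h
  exact Nat.eq_of_beq_eq_true h.1

lemma exists_closed : ∃ R : Set ℕ, pack (initMask (rows 0)) 3 0 ∈ R ∧
    ∀ s ∈ R, goodState balancedCodes s = true ∧ ∀ t ∈ succs (rows 0) (rows 1) s, t ∈ R := by
  have h := certificate_eq_true
  simp only [certificate, withRows_eq, withList_eq, withNat_eq, Bool.and_eq_true] at h
  obtain ⟨R, h1, h2⟩ := exists_closed_of_explore h.2 (by simp)
  exact ⟨R, h1 _ (by simp), h2⟩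

lemma unpack {m e q : ℕ} (he : e < 4) (hq : q < 67) :
    pack m e q / 67 / 4 = m ∧ pack m e q / 67 % 4 = e ∧ pack m e q % 67 = q := by
  unfold pack
  omega

/-- The transition function of the automaton. -/
def transition (q : Fin 67) (d : Fin 2) : Fin 67 := ⟨delta q d, Nat.mod_lt _ (by decide)⟩

/-- The state of the automaton after reading a digit string. -/
def run (L : List ℕ) : Fin 67 := L.foldl (fun q d => transition q (if d = 0 then 0 else 1)) 0

lemma run_concat (L : List ℕ) (d : ℕ) :
    run (L ++ [d]) = transition (run L) (if d = 0 then 0 else 1) := by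
  simp [run]

/-- In a closed set of states, every digit string without leading zeros and without three
consecutive ones leads to a state whose mask represents the word of the digit string. -/
lemma exists_state {R : Set ℕ} (h0 : pack (initMask (rows 0)) 3 0 ∈ R)
    (hR : ∀ s ∈ R, ∀ t ∈ succs (rows 0) (rows 1) s, t ∈ R) (L : List ℕ)
    (hL : ∀ d ∈ L, d ≤ 1) (hhead : ∀ d ∈ L.take 1, d = 1) (hinf : ¬ [1, 1, 1] <:+: L) :
    ∃ m e, e < 4 ∧ pack m e (run L) ∈ R ∧ Represents m (digitWord L) ∧ (e = 3 ↔ L = []) ∧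
      (e ≠ 3 → List.replicate e 1 <:+ L) := by
  induction L using List.reverseRecOn with
  | nil =>
    exact ⟨_, 3, by decide, h0, represents_initMask next_initMask, by simp, by simp⟩
  | append_singleton L d ih =>
    obtain ⟨m, e, he, hmR, hrep, he3, hsuf⟩ := ih (fun a ha => hL a (by simp [ha]))
      (fun a ha => hhead a (by cases L <;> simp_all))
      fun h => hinf (h.trans (List.prefix_append _ _).isInfix)
    have hd : d ≤ 1 := hL d (by simp)
    have hrep' := hrep.step (le_two_of_mem_digitWord L) hd
    rw [← digitWord_concat] at hrep'
    obtain ⟨hm, he', hq⟩ := unpack (m := m) he (run L).isLt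
    have hsucc := hR _ hmR
    simp only [succs, hm, he', hq, List.mem_append, Bool.cond_eq_ite, Nat.beq_eq] at hsucc
    rw [run_concat]
    interval_cases d
    · have he3' : e ≠ 3 := by
        rintro rfl
        rw [he3.1 rfl] at hhead
        simp at hhead
      refine ⟨_, 0, by decide, hsucc _ (.inl ?_), hrep', by simp, by simp⟩
      rw [if_neg he3']
      exact List.mem_singleton.2 rfl
    · have he2 : e ≠ 2 := by
        rintro rfl
        obtain ⟨t, rfl⟩ := hsuf (by decide)
        exact hinf ⟨t, [], by simp⟩
      refine ⟨_, if e = 3 then 1 else e + 1, by split_ifs <;> omega, hsucc _ (.inr ?_), hrep',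
        ?_, fun _ => ?_⟩
      · rw [if_neg he2]
        exact List.mem_singleton.2 rfl
      · simp only [List.append_eq_nil_iff, List.cons_ne_nil, and_false, iff_false]
        split_ifs <;> omega
      · split_ifs with h
        · exact List.suffix_append _ _
        · obtain ⟨t, ht⟩ := hsuf h
          exact ⟨t, by rw [List.replicate_succ', ← List.append_assoc, ht]⟩

lemma output_mem (q : Fin 67) : output q ∈ ({3, 4, 5, 6, 7} : Set ℕ) := by
  have h : ∀ q : Fin 67, output q ∈ ({3, 4, 5, 6, 7} : Finset ℕ) := by decide +kernel
  simpa using h q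

lemma mbAC_eq_output {n : ℕ} (hn : 1 ≤ n) {L : List ℕ} (hL : IsNormalTRep n L) :
    mbAC 3 n = output (run L) := by
  obtain ⟨R, h0, hR⟩ := exists_closed
  obtain ⟨m, e, he, hmR, hrep, he3, -⟩ := exists_state h0 (fun s hs => (hR s hs).2) L hL.1 hL.2.1
    (not_infix_of_isNormalTRep hL)
  have hgood := (hR _ hmR).1
  obtain ⟨hm, he', hq⟩ := unpack (m := m) he (run L).isLt
  have hne : e ≠ 3 := by
    intro h
    have := hL.2.2.1
    rw [he3.1 h] at this
    exact absurd hn (by simp [← this, valT])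
  rw [goodState, hm, he', hq, Bool.or_eq_true, Nat.beq_eq, Nat.beq_eq] at hgood
  rw [← hgood.resolve_left hne, numBalanced_balancedCodes hrep.1, hrep.2,
    ← mbAC_length (le_two_of_mem_digitWord L), length_digitWord, hL.2.2.1]

end TribonacciComplexity

theorem tribonacci_abelian_complexity_T_automatic :
    ∃ k : ℕ, 1 ≤ k ∧ k ≤ 68 ∧
      ∃ (δ : Fin k → Fin 2 → Fin k) (q0 : Fin k) (τ : Fin k → ℕ),
        (∀ q, τ q ∈ ({3, 4, 5, 6, 7} : Set ℕ)) ∧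
        ∀ n : ℕ, 1 ≤ n → ∀ L : List ℕ, IsNormalTRep n L →
          mbAC 3 n = τ (L.foldl (fun q d => δ q (if d = 0 then 0 else 1)) q0) :=
  ⟨67, by decide, by decide, TribonacciComplexity.transition, 0,
    fun q => TribonacciComplexity.output q, TribonacciComplexity.output_mem,
    fun _ hn _ hL => TribonacciComplexity.mbAC_eq_output hn hL⟩
end
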